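/- Assume Ω is connected. Then (Ω, J) is hyperbolic, i.e. the Kobayashi pseudodistance d_Ω satisfies d_Ω(p, q) > 0 whenever p ≠ q, if and only if for every compact set K ⊆ Ω one has inf { F_Ω(p, v) : p ∈ K, v ∈ ℂⁿ, ‖v‖ = 1 } > 0, where ‖·‖ is the standard norm on ℂⁿ (i.e. the Kobayashi–Royden pseudonorm restricted to unit vectors is bounded away from zero on compact subsets). -/

import Mathlib

open Metric Set Filter
open scoped ENNReal Topology

noncomputable section

abbrev Cn (n : ℕ) := EuclideanSpace ℂ (Fin n)

def IsAlmostComplexOn (n : ℕ) (Ω : Set (Cn n)) (J : Cn n → (Cn n →L[ℝ] Cn n)) : Prop :=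
  ContDiffOn ℝ (⊤ : ℕ∞) J Ω ∧
    ∀ x ∈ Ω, (J x).comp (J x) = -ContinuousLinearMap.id ℝ (Cn n)

def IsJHolomorphicOn (n : ℕ) (Ω : Set (Cn n)) (J : Cn n → (Cn n →L[ℝ] Cn n))
    (R : ℝ) (f : ℂ → Cn n) : Prop :=
  MapsTo f (ball (0:ℂ) R) Ω ∧
    ∀ z ∈ ball (0:ℂ) R, DifferentiableAt ℝ f z ∧
      ∀ ξ : ℂ, fderiv ℝ f z (Complex.I * ξ) = J (f z) (fderiv ℝ f z ξ)

def kobayashiRoyden (n : ℕ) (Ω : Set (Cn n)) (J : Cn n → (Cn n →L[ℝ] Cn n))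
    (p v : Cn n) : ℝ≥0∞ :=
  sInf {c : ℝ≥0∞ | ∃ r : ℝ, 0 < r ∧
    (∃ f : ℂ → Cn n, IsJHolomorphicOn n Ω J 1 f ∧ f 0 = p ∧ fderiv ℝ f 0 1 = r • v) ∧
    c = ENNReal.ofReal (1 / r)}

/-- The inverse hyperbolic tangent, `arctanh x = ½ log((1 + x)/(1 - x))`. -/
def arctanh (x : ℝ) : ℝ := (1 / 2) * Real.log ((1 + x) / (1 - x))

/-- The Poincaré distance on the unit disc. -/
def poincareDist (z w : ℂ) : ℝ :=
  arctanh (‖z - w‖ / ‖1 - (starRingEnd ℂ) z * w‖)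

/-- The Kobayashi pseudodistance `d_Ω(p, q)` of the almost complex manifold `(Ω, J)`. -/
def kobayashiDist (n : ℕ) (Ω : Set (Cn n)) (J : Cn n → (Cn n →L[ℝ] Cn n))
    (p q : Cn n) : ℝ≥0∞ :=
  sInf {c : ℝ≥0∞ | ∃ m : ℕ, ∃ z w : Fin (m + 1) → ℂ, ∃ f : Fin (m + 1) → ℂ → Cn n,
    (∀ k, z k ∈ ball (0:ℂ) 1 ∧ w k ∈ ball (0:ℂ) 1 ∧ IsJHolomorphicOn n Ω J 1 (f k)) ∧
    f 0 (z 0) = p ∧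
    (∀ k : Fin m, f k.castSucc (w k.castSucc) = f k.succ (z k.succ)) ∧
    f (Fin.last m) (w (Fin.last m)) = q ∧
    c = ENNReal.ofReal (∑ k, poincareDist (z k) (w k))}

/-- `γ` is a piecewise continuously differentiable path in `Ω`, parametrized by `[0,1]`. -/
def IsPiecewiseC1PathIn (n : ℕ) (Ω : Set (Cn n)) (γ : ℝ → Cn n) : Prop :=
  ContinuousOn γ (Icc (0:ℝ) 1) ∧ MapsTo γ (Icc (0:ℝ) 1) Ω ∧
    ∃ (k : ℕ) (t : Fin (k + 1) → ℝ), StrictMono t ∧ t 0 = 0 ∧ t (Fin.last k) = 1 ∧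
      ∀ i : Fin k, ContDiffOn ℝ 1 γ (Icc (t i.castSucc) (t i.succ))

/-- The Kobayashi–Royden length `∫₀¹ F_Ω(γ(t), γ′(t)) dt` of a path. -/
def kobayashiRoydenLength (n : ℕ) (Ω : Set (Cn n)) (J : Cn n → (Cn n →L[ℝ] Cn n))
    (γ : ℝ → Cn n) : ℝ≥0∞ :=
  ∫⁻ t in Icc (0:ℝ) 1, kobayashiRoyden n Ω J (γ t) (deriv γ t)

/-- The integrated Kobayashi–Royden pseudodistance `d̄_Ω(p, q)`. -/
def integratedKRDist (n : ℕ) (Ω : Set (Cn n)) (J : Cn n → (Cn n →L[ℝ] Cn n))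
    (p q : Cn n) : ℝ≥0∞ :=
  ⨅ γ : {γ : ℝ → Cn n // IsPiecewiseC1PathIn n Ω γ ∧ γ 0 = p ∧ γ 1 = q},
    kobayashiRoydenLength n Ω J γ

noncomputable section

lemma fderiv_comp_hol {E : Type*} [NormedAddCommGroup E] [NormedSpace ℝ E] {f : ℂ → E} {φ : ℂ → ℂ} {z : ℂ}
    (hf : DifferentiableAt ℝ f (φ z)) (hφ : DifferentiableAt ℂ φ z) :
    DifferentiableAt ℝ (fun w => f (φ w)) z ∧
    ∀ ξ : ℂ, fderiv ℝ (fun w => f (φ w)) z ξ = fderiv ℝ f (φ z) (deriv φ z * ξ) := by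
  have h1 : HasFDerivAt φ ((ContinuousLinearMap.toSpanSingleton ℂ (deriv φ z)).restrictScalars ℝ) z :=
    hφ.hasDerivAt.hasFDerivAt.restrictScalars ℝ
  have h2 := hf.hasFDerivAt.comp z h1
  refine ⟨h2.differentiableAt, fun ξ => ?_⟩
  have h3 : HasFDerivAt (fun w => f (φ w)) _ z := h2
  rw [h3.fderiv]
  simp [mul_comm]

lemma jhol_comp {n : ℕ} {Ω : Set (Cn n)} {J : Cn n → (Cn n →L[ℝ] Cn n)} {R R' : ℝ} {f : ℂ → Cn n}
    {φ : ℂ → ℂ} (hf : IsJHolomorphicOn n Ω J R f) (hm : MapsTo φ (ball 0 R') (ball 0 R))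
    (hd : ∀ z ∈ ball (0:ℂ) R', DifferentiableAt ℂ φ z) :
    IsJHolomorphicOn n Ω J R' (fun w => f (φ w)) := by
  refine ⟨fun z hz => hf.1 (hm hz), fun z hz => ?_⟩
  obtain ⟨h1, h2⟩ := fderiv_comp_hol (hf.2 _ (hm hz)).1 (hd z hz)
  refine ⟨h1, fun ξ => ?_⟩
  rw [h2, h2, ← (hf.2 _ (hm hz)).2]
  congr 1; ring

def mob (a ζ : ℂ) : ℂ := (ζ + a) / (1 + (starRingEnd ℂ) a * ζ)

lemma mob_key (a ζ : ℂ) : ‖1 + (starRingEnd ℂ) a * ζ‖ ^ 2 - ‖ζ + a‖ ^ 2 = (1 - ‖a‖ ^ 2) * (1 - ‖ζ‖ ^ 2) := by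
  simp only [Complex.sq_norm, Complex.normSq_apply]
  simp
  ring

lemma mob_den {a ζ : ℂ} (ha : ‖a‖ < 1) (hζ : ‖ζ‖ < 1) : 1 + (starRingEnd ℂ) a * ζ ≠ 0 := by
  intro h
  have : (starRingEnd ℂ) a * ζ = -1 := by linear_combination h
  have h2 : ‖(starRingEnd ℂ) a * ζ‖ = 1 := by rw [this]; simp
  rw [norm_mul, RCLike.norm_conj] at h2
  nlinarith [norm_nonneg a, norm_nonneg ζ]

lemma mob_maps {a : ℂ} (ha : ‖a‖ < 1) : MapsTo (mob a) (ball 0 1) (ball 0 1) := by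
  intro ζ hζ
  rw [mem_ball_zero_iff] at *
  have hd := mob_den ha hζ
  have := mob_key a ζ
  rw [mob, norm_div, div_lt_one (norm_pos_iff.2 hd)]
  apply lt_of_pow_lt_pow_left₀ 2 (norm_nonneg _)
  have h1 : 0 < 1 - ‖a‖ ^ 2 := by nlinarith [norm_nonneg a]
  have h2 : 0 < 1 - ‖ζ‖ ^ 2 := by nlinarith [norm_nonneg ζ]
  nlinarith [mul_pos h1 h2]

lemma mob_hasDeriv {a ζ : ℂ} (ha : ‖a‖ < 1) (hζ : ‖ζ‖ < 1) :
    HasDerivAt (mob a) ((1 * (1 + (starRingEnd ℂ) a * ζ) - (ζ + a) * ((starRingEnd ℂ) a * 1)) /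
      (1 + (starRingEnd ℂ) a * ζ) ^ 2) ζ := by
  exact ((hasDerivAt_id ζ).add_const a).div (((hasDerivAt_id ζ).const_mul _).const_add 1) (mob_den ha hζ)

lemma arctanh_deriv {x : ℝ} (h0 : -1 < x) (h1 : x < 1) : HasDerivAt arctanh (1 / (1 - x ^ 2)) x := by
  have ha : 0 < 1 + x := by linarith
  have hb : 0 < 1 - x := by linarith
  have h := ((((hasDerivAt_id x).const_add 1).div ((hasDerivAt_id x).const_sub 1) hb.ne').log
    (div_pos ha hb).ne').const_mul (1/2 : ℝ)
  refine h.congr_deriv ?_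
  have : 1 - x ^ 2 ≠ 0 := by nlinarith [mul_pos ha hb]
  simp
  field_simp
  ring

lemma arctanh_zero : arctanh 0 = 0 := by simp [arctanh]

lemma arctanh_mono {x y : ℝ} (hx : 0 ≤ x) (hxy : x ≤ y) (hy : y < 1) : arctanh x ≤ arctanh y := by
  unfold arctanh
  have : (1 + x) / (1 - x) ≤ (1 + y) / (1 - y) := by
    rw [div_le_div_iff₀ (by linarith) (by linarith)]; nlinarith
  have h2 : 0 < (1 + x) / (1 - x) := div_pos (by linarith) (by linarith)
  have := Real.log_le_log h2 this
  linarith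

lemma arctanh_nonneg {y : ℝ} (hx : 0 ≤ y) (hy : y < 1) : 0 ≤ arctanh y := by
  have := arctanh_mono le_rfl hx hy
  rwa [arctanh_zero] at this

/-- derivative bound from lower bound of `F` -/
lemma deriv_bound {n : ℕ} {Ω : Set (Cn n)} {J : Cn n → (Cn n →L[ℝ] Cn n)} {K : Set (Cn n)} {c : ℝ} (hc : 0 < c)
    (hF : ∀ p ∈ K, ∀ v : Cn n, ‖v‖ = 1 → ENNReal.ofReal c ≤ kobayashiRoyden n Ω J p v)
    {f : ℂ → Cn n} (hf : IsJHolomorphicOn n Ω J 1 f) {z : ℂ} (hz : ‖z‖ < 1) (hfz : f z ∈ K) :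
    ‖fderiv ℝ f z 1‖ ≤ 1 / c * (1 / (1 - ‖z‖ ^ 2)) := by
  have hpos : 0 < 1 - ‖z‖ ^ 2 := by nlinarith [norm_nonneg z]
  -- version at 0
  have key : ∀ g : ℂ → Cn n, IsJHolomorphicOn n Ω J 1 g → g 0 ∈ K → ‖fderiv ℝ g 0 1‖ ≤ 1 / c := by
    intro g hg hgK
    by_cases h0 : fderiv ℝ g 0 1 = 0
    · rw [h0]; simp [hc.le]
    have hr : 0 < ‖fderiv ℝ g 0 1‖ := norm_pos_iff.2 h0
    set r := ‖fderiv ℝ g 0 1‖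
    have h1 := hF (g 0) hgK (r⁻¹ • fderiv ℝ g 0 1) (by rw [norm_smul]; simp [r]; field_simp)
    have h2 : kobayashiRoyden n Ω J (g 0) (r⁻¹ • fderiv ℝ g 0 1) ≤ ENNReal.ofReal (1 / r) := by
      apply sInf_le
      refine ⟨r, hr, ⟨g, hg, rfl, ?_⟩, rfl⟩
      rw [smul_smul, mul_inv_cancel₀ hr.ne', one_smul]
    have h3 := h1.trans h2
    rw [ENNReal.ofReal_le_ofReal_iff (by positivity)] at h3
    rw [le_div_iff₀ hr] at h3
    rw [le_div_iff₀ hc]; linarith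
  -- compose with the Moebius map
  have hm := mob_maps hz
  have hd : ∀ ζ ∈ ball (0:ℂ) 1, DifferentiableAt ℂ (mob z) ζ := fun ζ hζ =>
    (mob_hasDeriv hz (mem_ball_zero_iff.1 hζ)).differentiableAt
  have hm0 : mob z 0 = z := by simp [mob]
  have hg := jhol_comp hf hm hd
  have h1 := key _ hg (by simpa [hm0] using hfz)
  have h0 : (0:ℂ) ∈ ball (0:ℂ) 1 := by simp
  have h2 := (fderiv_comp_hol (f := f) (φ := mob z) (z := 0) (hf.2 _ (hm h0)).1 (hd 0 h0)).2 1
  rw [h2, (mob_hasDeriv hz (by simp)).deriv, hm0] at h1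
  have h4 : (1 * (1 + (starRingEnd ℂ) z * 0) - (0 + z) * ((starRingEnd ℂ) z * 1)) /
      (1 + (starRingEnd ℂ) z * 0) ^ 2 * 1 = (((1 - ‖z‖ ^ 2 : ℝ)) : ℂ) := by
    simp [Complex.mul_conj, Complex.normSq_eq_norm_sq]
  rw [h4] at h1
  have h5 : fderiv ℝ f z (((1 - ‖z‖ ^ 2 : ℝ)) : ℂ) = (1 - ‖z‖ ^ 2) • fderiv ℝ f z 1 := by
    rw [← map_smul]; simp
  rw [h5, norm_smul, Real.norm_of_nonneg hpos.le] at h1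
  rw [mul_one_div, le_div_iff₀ hpos]; linarith

lemma disc_step {n : ℕ} {Ω : Set (Cn n)} {J : Cn n → (Cn n →L[ℝ] Cn n)} {p : Cn n} {ε c : ℝ} (hc : 0 < c)
    (hF : ∀ p' ∈ closedBall p ε, ∀ v : Cn n, ‖v‖ = 1 → ENNReal.ofReal c ≤ kobayashiRoyden n Ω J p' v)
    {f : ℂ → Cn n} (hf : IsJHolomorphicOn n Ω J 1 f) {z w : ℂ} (hz : ‖z‖ < 1) (hw : ‖w‖ < 1) :
    min ‖f w - p‖ ε ≤ min ‖f z - p‖ ε + 2 / c * poincareDist z w ∧ 0 ≤ poincareDist z w := by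
  set ω : ℂ := mob (-z) w with hω
  have hω1 : ‖ω‖ < 1 := by
    have := mob_maps (a := -z) (by simpa using hz) (mem_ball_zero_iff.2 hw)
    simpa using this
  set s := ‖ω‖ with hs
  have hsn : 0 ≤ s := norm_nonneg _
  have hρ : poincareDist z w = arctanh s := by
    rw [poincareDist, hs, hω, mob, norm_div, norm_sub_rev z w]
    simp [sub_eq_add_neg]
  rw [hρ]
  have hnn := arctanh_nonneg hsn hω1
  refine ⟨?_, hnn⟩
  have hcc : 0 < 2 / c := by positivity
  by_cases hε : ε ≤ ‖f z - p‖
  · rw [min_eq_right hε]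
    exact (min_le_right _ _).trans (by nlinarith)
  push Not at hε
  rw [min_eq_left hε.le]
  by_cases hB : ε ≤ ‖f z - p‖ + 2 / c * arctanh s
  · exact (min_le_right _ _).trans hB
  push Not at hB
  refine (min_le_left _ _).trans ?_
  obtain ⟨e, he, hes⟩ : ∃ e : ℂ, ‖e‖ = 1 ∧ s * e = ω := by
    by_cases h0 : ω = 0
    · exact ⟨1, by simp, by simp [hs, h0]⟩
    · refine ⟨ω / s, ?_, ?_⟩
      · rw [norm_div]; simp [hs, h0]
      · have : (s:ℂ) ≠ 0 := by simp [hs, h0]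
        field_simp
  have hmm : MapsTo (fun ζ => mob z (ζ * e)) (ball 0 1) (ball 0 1) := by
    intro ζ hζ
    exact mob_maps hz (by simpa [he] using hζ)
  have hmd : ∀ ζ ∈ ball (0:ℂ) 1, DifferentiableAt ℂ (fun ζ => mob z (ζ * e)) ζ := by
    intro ζ hζ
    have h1 : DifferentiableAt ℂ (mob z) (ζ * e) :=
      (mob_hasDeriv hz (by simpa [he] using hζ)).differentiableAt
    exact h1.comp ζ (f := fun ζ => ζ * e) (by fun_prop)
  have hg := jhol_comp hf hmm hmd
  set g : ℂ → Cn n := fun ζ => f (mob z (ζ * e)) with hgdef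
  have hg0 : g 0 = f z := by simp [hgdef, mob]
  have hgs : g s = f w := by
    simp only [hgdef, hes]
    congr 1
    rw [hω]
    have h1 := mob_den (a := -z) (by simpa using hz) hw
    have h1' : 1 - (starRingEnd ℂ) z * w ≠ 0 := by simpa [sub_eq_add_neg] using h1
    have h2 := mob_den hz hω1
    simp only [hω, mob] at h2 ⊢
    rw [div_eq_iff h2]
    simp only [map_neg, neg_mul, ← sub_eq_add_neg]
    have h3 : (w - z) / (1 - (starRingEnd ℂ) z * w) * (1 - (starRingEnd ℂ) z * w) = w - z :=
      div_mul_cancel₀ _ h1'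
    apply mul_right_cancel₀ h1'
    linear_combination (1 - w * (starRingEnd ℂ) z) * h3
  have hmain := image_norm_le_of_norm_deriv_right_lt_deriv_boundary' (a := 0) (b := s)
    (f := fun t : ℝ => g t - p) (f' := fun t : ℝ => fderiv ℝ g t 1)
    (B := fun t => ‖f z - p‖ + 2 / c * arctanh t) (B' := fun t => 2 / c * (1 / (1 - t ^ 2))) ?_ ?_ ?_ ?_ ?_ ?_
    (right_mem_Icc.2 hsn)
  · simpa [hgs] using hmain
  · intro t ht
    have htb : (t:ℂ) ∈ ball (0:ℂ) 1 := by
      rw [mem_ball_zero_iff]; simp [abs_of_nonneg ht.1]; linarith [ht.2]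
    have h1 : ContinuousAt g t := (hg.2 _ htb).1.continuousAt
    have h2 : ContinuousAt (fun t : ℝ => g t) t := h1.comp (f := fun t : ℝ => (t:ℂ)) (by fun_prop)
    exact (h2.sub continuousAt_const).continuousWithinAt
  · intro t ht
    have htb : (t:ℂ) ∈ ball (0:ℂ) 1 := by
      rw [mem_ball_zero_iff]; simp [abs_of_nonneg ht.1]; linarith [ht.2]
    have h1 := (hg.2 _ htb).1.hasFDerivAt
    have h2 := h1.comp_hasDerivAt t (Complex.ofRealCLM.hasDerivAt (x := t))
    have h3 : HasDerivAt (fun t : ℝ => g t - p) (fderiv ℝ g t 1) t := by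
      simpa using h2.sub_const p
    exact h3.hasDerivWithinAt
  · simp [hg0, arctanh_zero]
  · intro t ht
    have := (arctanh_deriv (x := t) (by linarith [ht.1]) (by linarith [ht.2])).continuousAt
    exact (continuousAt_const.add (continuousAt_const.mul this)).continuousWithinAt
  · intro t ht
    have := (arctanh_deriv (x := t) (by linarith [ht.1]) (by linarith [ht.2]))
    exact ((this.const_mul (2 / c)).const_add _).hasDerivWithinAt
  · intro t ht heq
    have hn : ‖(t:ℂ)‖ = t := by simp [abs_of_nonneg ht.1]
    have ht1 : t < 1 := by linarith [ht.2]
    have hK : g t ∈ closedBall p ε := by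
      rw [mem_closedBall, dist_eq_norm, heq]
      have := arctanh_mono ht.1 ht.2.le hω1
      nlinarith
    have h1 := deriv_bound hc hF hg (z := t) (by rw [hn]; exact ht1) hK
    rw [hn] at h1
    refine h1.trans_lt ?_
    have : 0 < 1 / (1 - t ^ 2) := by
      apply one_div_pos.2; nlinarith [ht.1]
    have h2 : 1 / c < 2 / c := by
      apply div_lt_div_of_pos_right _ hc; norm_num
    exact mul_lt_mul_of_pos_right h2 this

lemma bounded_below_imp_hyperbolic
    {n : ℕ} {Ω : Set (Cn n)} (hΩ : IsOpen Ω) {J : Cn n → (Cn n →L[ℝ] Cn n)}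
    (h : ∀ K : Set (Cn n), K ⊆ Ω → IsCompact K →
        0 < sInf {c : ℝ≥0∞ | ∃ p ∈ K, ∃ v : Cn n, ‖v‖ = 1 ∧
          c = kobayashiRoyden n Ω J p v}) {p q : Cn n} (hp : p ∈ Ω) (hpq : p ≠ q) :
    0 < kobayashiDist n Ω J p q := by
  obtain ⟨ε1, hε1, hb⟩ := Metric.isOpen_iff.1 hΩ p hp
  set ε := min (ε1 / 2) ‖q - p‖ with hεdef
  have hqp : 0 < ‖q - p‖ := norm_pos_iff.2 (sub_ne_zero.2 hpq.symm)
  have hε : 0 < ε := lt_min (by linarith) hqp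
  have hsub : closedBall p ε ⊆ Ω := fun x hx => hb (by
    rw [mem_closedBall] at hx; rw [mem_ball]
    have : ε ≤ ε1 / 2 := min_le_left _ _
    linarith)
  have h0 := h _ hsub (isCompact_closedBall p ε)
  obtain ⟨c, hc0, hc⟩ : ∃ c : ℝ, 0 < c ∧ ENNReal.ofReal c ≤ sInf {c : ℝ≥0∞ | ∃ p' ∈ closedBall p ε, ∃ v : Cn n, ‖v‖ = 1 ∧
          c = kobayashiRoyden n Ω J p' v} := by
    obtain ⟨r, hr0, hr⟩ := ENNReal.lt_iff_exists_nnreal_btwn.1 h0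
    exact ⟨r, by simpa using hr0, by simpa using hr.le⟩
  have hF : ∀ p' ∈ closedBall p ε, ∀ v : Cn n, ‖v‖ = 1 → ENNReal.ofReal c ≤ kobayashiRoyden n Ω J p' v := by
    intro p' hp' v hv
    exact hc.trans (sInf_le ⟨p', hp', v, hv, rfl⟩)
  have hpos : 0 < c * ε / 2 := by positivity
  refine lt_of_lt_of_le (ENNReal.ofReal_pos.2 hpos) ?_
  apply le_sInf
  rintro _ ⟨m, z, w, f, hk, hp0, hch, hq, rfl⟩
  apply ENNReal.ofReal_le_ofReal
  have hstep : ∀ k, min ‖f k (w k) - p‖ ε ≤ min ‖f k (z k) - p‖ ε + 2 / c * poincareDist (z k) (w k) ∧ _ :=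
    fun k => disc_step hc0 hF (hk k).2.2 (mem_ball_zero_iff.1 (hk k).1) (mem_ball_zero_iff.1 (hk k).2.1)
  have hind : ∀ k : Fin (m+1), min ‖f k (w k) - p‖ ε ≤ 2 / c * ∑ i ∈ Finset.univ.filter (fun i => i ≤ k), poincareDist (z i) (w i) := by
    intro k
    induction k using Fin.induction with
    | zero =>
      have := (hstep 0).1
      rw [hp0, sub_self, norm_zero, min_eq_left hε.le, zero_add] at this
      refine this.trans (le_of_eq ?_)
      have : (Finset.univ.filter (fun i : Fin (m+1) => i ≤ 0)) = {0} := by ext i; simp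
      rw [this]; simp
    | succ k ih =>
      have h1 := (hstep k.succ).1
      rw [← hch k] at h1
      have : (Finset.univ.filter (fun i : Fin (m+1) => i ≤ k.succ)) =
          insert k.succ (Finset.univ.filter (fun i : Fin (m+1) => i ≤ k.castSucc)) := by
        ext i; simp [Fin.le_def, Fin.ext_iff]; omega
      rw [this, Finset.sum_insert (by simp [Fin.le_def])]
      linarith [mul_add (2/c) (poincareDist (z k.succ) (w k.succ)) (∑ i ∈ Finset.univ.filter (fun i => i ≤ k.castSucc), poincareDist (z i) (w i))]
  have hl := hind (Fin.last m)
  have : (Finset.univ.filter (fun i : Fin (m+1) => i ≤ Fin.last m)) = Finset.univ := by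
    ext i; simp [Fin.le_last]
  rw [this, hq, min_eq_right (min_le_right _ _)] at hl
  rw [div_mul_eq_mul_div, le_div_iff₀ hc0] at hl
  linarith
end

noncomputable section
set_option linter.unusedSimpArgs false

lemma core_deriv {n : ℕ} {F : ℂ → Cn n} {w : ℂ} (hd : DifferentiableAt ℝ F (Complex.exp w)) :
    DifferentiableAt ℝ (fun w => Complex.exp (-w) • F (Complex.exp w)) w ∧
    Complex.I • fderiv ℝ (fun w => Complex.exp (-w) • F (Complex.exp w)) w 1 -
      fderiv ℝ (fun w => Complex.exp (-w) • F (Complex.exp w)) w Complex.I =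
      Complex.exp (-w) • (Complex.I • fderiv ℝ F (Complex.exp w) (Complex.exp w) -
        fderiv ℝ F (Complex.exp w) (Complex.I * Complex.exp w)) := by
  obtain ⟨h1, h2⟩ := fderiv_comp_hol (φ := Complex.exp) (z := w) hd (by fun_prop)
  have h3 : HasDerivAt (fun w : ℂ => Complex.exp (-w)) (-Complex.exp (-w)) w := by
    simpa using (hasDerivAt_neg w).cexp
  have h4 : HasFDerivAt (fun w : ℂ => Complex.exp (-w))
    ((ContinuousLinearMap.toSpanSingleton ℂ (-Complex.exp (-w))).restrictScalars ℝ) w :=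
    h3.hasFDerivAt.restrictScalars ℝ
  have h5 := h4.smul h1.hasFDerivAt
  refine ⟨h5.differentiableAt, ?_⟩
  have h6 : HasFDerivAt (fun w => Complex.exp (-w) • F (Complex.exp w)) _ w := h5
  rw [h6.fderiv]
  simp only [add_apply, smul_apply, h2,
    ContinuousLinearMap.smulRight_apply, ContinuousLinearMap.coe_restrictScalars',
    ContinuousLinearMap.toSpanSingleton_apply, Complex.deriv_exp]
  rw [mul_one, mul_comm (Complex.exp w) Complex.I]
  simp only [smul_add, smul_sub, smul_smul, one_smul, smul_eq_mul]
  rw [mul_comm Complex.I (Complex.exp (-w))]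
  simp

lemma core_est {n : ℕ} {F : ℂ → Cn n} {ρ R a ε : ℝ} (hR : 0 < R) (hRρ : R < ρ) (ha : 0 ≤ a)
    (hd : ∀ z ∈ ball (0:ℂ) ρ, DifferentiableAt ℝ F z) (hF0 : F 0 = 0)
    (hb : ∀ z ∈ ball (0:ℂ) ρ, ‖F z‖ ≤ ε)
    (hbar : ∀ z ∈ ball (0:ℂ) ρ, ∀ ξ : ℂ,
      ‖Complex.I • fderiv ℝ F z ξ - fderiv ℝ F z (Complex.I * ξ)‖ ≤ a * ‖z‖ * ‖ξ‖) :
    ‖fderiv ℝ F 0 1‖ ≤ ε / R + a * R := by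
  set Φ : ℂ → Cn n := fun w => Complex.exp (-w) • F (Complex.exp w) with hΦ
  have hin : ∀ w : ℂ, w.re ≤ Real.log R → Complex.exp w ∈ ball (0:ℂ) ρ := by
    intro w hw
    rw [mem_ball_zero_iff, Complex.norm_exp]
    calc Real.exp w.re ≤ Real.exp (Real.log R) := Real.exp_le_exp.2 hw
      _ = R := Real.exp_log hR
      _ < ρ := hRρ
  have hΦd : ∀ w : ℂ, w.re ≤ Real.log R → DifferentiableAt ℝ Φ w := fun w hw =>
    (core_deriv (hd _ (hin w hw))).1
  have hΦb : ∀ w : ℂ, w.re ≤ Real.log R →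
      ‖Complex.I • fderiv ℝ Φ w 1 - fderiv ℝ Φ w Complex.I‖ ≤ a * Real.exp w.re := by
    intro w hw
    rw [(core_deriv (hd _ (hin w hw))).2, norm_smul, Complex.norm_exp]
    have h1 := hbar _ (hin w hw) (Complex.exp w)
    rw [Complex.norm_exp] at h1
    calc _ ≤ Real.exp (-w).re * (a * Real.exp w.re * Real.exp w.re) := by gcongr
      _ = (Real.exp (-w.re) * Real.exp w.re) * (a * Real.exp w.re) := by simp; ring
      _ = _ := by rw [← Real.exp_add]; simp
  -- the circle average
  set A : ℝ → Cn n := fun u => ∫ y : ℝ in (0:ℝ)..(2 * Real.pi), Φ (u + y * Complex.I) with hA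
  have hpi := Real.pi_pos
  have hAdiff : ∀ u ≤ Real.log R, ‖A (Real.log R) - A u‖ ≤ 2 * Real.pi * (a * R) := by
    intro u hu
    have hz : ∀ w : ℂ, w ∈ (uIcc (u:ℂ).re ((Real.log R : ℝ) + (2 * Real.pi : ℝ) * Complex.I : ℂ).re ×ℂ
        uIcc (u:ℂ).im ((Real.log R : ℝ) + (2 * Real.pi : ℝ) * Complex.I : ℂ).im) → w.re ≤ Real.log R := by
      intro w hw
      have := hw.1
      simp only [mem_preimage, Complex.ofReal_re, Complex.add_re, Complex.re_ofReal_mul, Complex.I_re, mul_zero, add_zero,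
        uIcc_of_le hu] at this
      exact this.2
    have h := Complex.integral_boundary_rect_of_hasFDerivAt_real_off_countable Φ (fderiv ℝ Φ)
      (u : ℂ) ((Real.log R : ℝ) + (2 * Real.pi : ℝ) * Complex.I) ∅ countable_empty ?_ ?_ ?_
    rotate_left
    · intro w hw
      exact (hΦd w (hz w hw)).continuousAt.continuousWithinAt
    · intro w hw
      refine (hΦd w ?_).hasFDerivAt
      have := hw.1.1
      simp only [mem_preimage, Complex.ofReal_re, Complex.add_re, Complex.re_ofReal_mul, Complex.I_re, mul_zero, add_zero,
        min_eq_left hu, max_eq_right hu] at this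
      exact this.2.le
    · have hcomp : IsCompact (uIcc (u:ℂ).re ((Real.log R : ℝ) + (2 * Real.pi : ℝ) * Complex.I : ℂ).re ×ℂ
        uIcc (u:ℂ).im ((Real.log R : ℝ) + (2 * Real.pi : ℝ) * Complex.I : ℂ).im) :=
        isCompact_uIcc.reProdIm isCompact_uIcc
      refine MeasureTheory.Measure.integrableOn_of_bounded (M := a * R) hcomp.measure_lt_top.ne ?_ ?_
      · have h1 := (measurable_fderiv_apply_const ℝ Φ 1)
        have h2 := (measurable_fderiv_apply_const ℝ Φ Complex.I)
        exact ((h1.const_smul Complex.I).sub h2).aestronglyMeasurable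
      · refine (MeasureTheory.ae_restrict_iff' hcomp.measurableSet).2 (Eventually.of_forall fun w hw => ?_)
        refine (hΦb w (hz w hw)).trans ?_
        gcongr
        calc Real.exp w.re ≤ Real.exp (Real.log R) := Real.exp_le_exp.2 (hz w hw)
          _ = R := Real.exp_log hR
    have hper : ∀ x : ℝ, Φ (x + ((2 * Real.pi : ℝ) : ℂ) * Complex.I) = Φ (x + (0:ℝ) * Complex.I) := by
      intro x
      simp only [hΦ]
      have h1 : Complex.exp (x + ((2 * Real.pi : ℝ) : ℂ) * Complex.I) = Complex.exp (x + (0:ℝ) * Complex.I) := by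
        rw [Complex.exp_add]; push_cast; rw [Complex.exp_two_pi_mul_I]; simp
      rw [Complex.exp_neg, Complex.exp_neg, h1]
    simp only [Complex.ofReal_re, Complex.ofReal_im, Complex.add_re, Complex.re_ofReal_mul, Complex.I_re, mul_zero, add_zero,
      Complex.add_im, Complex.im_ofReal_mul, Complex.I_im, mul_one, zero_add, hper, sub_self] at h
    rw [← smul_sub] at h
    have h' : ‖A (Real.log R) - A u‖ = ‖∫ (x : ℝ) in u..Real.log R, ∫ (y : ℝ) in 0..2 * Real.pi,
        Complex.I • fderiv ℝ Φ (↑x + ↑y * Complex.I) 1 - fderiv ℝ Φ (↑x + ↑y * Complex.I) Complex.I‖ := by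
      rw [← h, norm_smul, Complex.norm_I, one_mul]
    rw [h']
    calc _ ≤ ∫ x in u..Real.log R, 2 * Real.pi * a * Real.exp x := by
          apply intervalIntegral.norm_integral_le_of_norm_le hu
          · refine Eventually.of_forall fun x hx => ?_
            have := intervalIntegral.norm_integral_le_of_norm_le_const (a := 0) (b := 2 * Real.pi)
              (f := fun y : ℝ => Complex.I • fderiv ℝ Φ (↑x + ↑y * Complex.I) 1 - fderiv ℝ Φ (↑x + ↑y * Complex.I) Complex.I)
              (C := a * Real.exp x) (fun y hy => by
                have := hΦb (x + y * Complex.I) (by simpa using hx.2)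
                simpa using this)
            refine this.trans (le_of_eq ?_)
            rw [sub_zero, abs_of_pos (by positivity)]; ring
          · exact (by fun_prop : Continuous fun x => 2 * Real.pi * a * Real.exp x).intervalIntegrable _ _
      _ = 2 * Real.pi * a * (R - Real.exp u) := by
          rw [intervalIntegral.integral_const_mul, integral_exp, Real.exp_log hR]
      _ ≤ _ := by
          have : 0 ≤ 2 * Real.pi * a * Real.exp u := by positivity
          nlinarith
  have hAR : ‖A (Real.log R)‖ ≤ 2 * Real.pi * (ε / R) := by
    have := intervalIntegral.norm_integral_le_of_norm_le_const (a := 0) (b := 2 * Real.pi)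
      (f := fun y : ℝ => Φ ((Real.log R : ℝ) + y * Complex.I)) (C := ε / R) (fun y hy => by
        have h1 := hb _ (hin ((Real.log R : ℝ) + y * Complex.I) (by simp))
        simp only [hΦ, norm_smul, Complex.norm_exp]
        have : Real.exp ((-((Real.log R : ℝ) + y * Complex.I) : ℂ)).re = R⁻¹ := by
          simp [Real.exp_neg, Real.exp_log hR]
        rw [this, div_eq_inv_mul]
        gcongr)
    refine this.trans (le_of_eq ?_)
    rw [sub_zero, abs_of_pos (by positivity)]; ring
  -- limit at 0
  have h0mem : (0:ℂ) ∈ ball (0:ℂ) ρ := by simp; linarith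
  have hlin : ∀ ξ : ℂ, fderiv ℝ F 0 ξ = ξ • fderiv ℝ F 0 1 := by
    have hI : fderiv ℝ F 0 Complex.I = Complex.I • fderiv ℝ F 0 1 := by
      have := hbar 0 h0mem 1
      simp only [norm_zero, mul_zero, zero_mul, mul_one] at this
      exact (sub_eq_zero.1 (norm_le_zero_iff.1 this)).symm
    intro ξ
    have : ξ = ξ.re • (1:ℂ) + ξ.im • Complex.I := by
      simp [Complex.re_add_im]
    conv_lhs => rw [this]
    rw [map_add, map_smul, map_smul, hI]
    conv_rhs => rw [this]
    rw [add_smul]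
    congr 1
    · simp
    · rw [← smul_assoc]
  refine le_of_forall_pos_le_add fun η hη => ?_
  have hderiv := (hd 0 h0mem).hasFDerivAt
  have hlo := (hasFDerivAt_iff_isLittleO_nhds_zero.1 hderiv).def hη
  obtain ⟨δ, hδ, hδb⟩ := Metric.eventually_nhds_iff.1 hlo
  set u := min (Real.log R) (Real.log (δ / 2)) with hu
  have huR : u ≤ Real.log R := min_le_left _ _
  have hAu : ‖A u - (2 * Real.pi) • fderiv ℝ F 0 1‖ ≤ 2 * Real.pi * η := by
    have hI : A u - (2 * Real.pi) • fderiv ℝ F 0 1 =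
        ∫ y : ℝ in (0:ℝ)..(2 * Real.pi), (Φ (u + y * Complex.I) - fderiv ℝ F 0 1) := by
      rw [intervalIntegral.integral_sub]
      · simp [hA]
      · apply ContinuousOn.intervalIntegrable
        intro y hy
        have h1 : ContinuousAt Φ (u + y * Complex.I) := (hΦd _ (by simpa using huR)).continuousAt
        exact (h1.comp (f := fun y : ℝ => (u + y * Complex.I : ℂ)) (by fun_prop)).continuousWithinAt
      · simp
    rw [hI]
    refine (intervalIntegral.norm_integral_le_of_norm_le_const (C := η) (fun y hy => ?_)).trans (le_of_eq ?_)
    · have hlt : ‖Complex.exp (u + y * Complex.I)‖ < δ := by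
        rw [Complex.norm_exp]
        have : ((u:ℂ) + y * Complex.I).re = u := by simp
        rw [this]
        calc Real.exp u ≤ Real.exp (Real.log (δ/2)) := Real.exp_le_exp.2 (min_le_right _ _)
          _ = δ / 2 := Real.exp_log (by linarith)
          _ < δ := by linarith
      have h1 := hδb (y := Complex.exp (u + y * Complex.I)) (by simpa using hlt)
      rw [zero_add, hF0, sub_zero, hlin] at h1
      have h2 : Φ (u + y * Complex.I) - fderiv ℝ F 0 1 = Complex.exp (-(u + y * Complex.I)) •
          (F (Complex.exp (u + y * Complex.I)) - Complex.exp (u + y * Complex.I) • fderiv ℝ F 0 1) := by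
        rw [smul_sub, smul_smul, ← Complex.exp_add, neg_add_cancel, Complex.exp_zero, one_smul]
      rw [h2, norm_smul]
      calc _ ≤ ‖Complex.exp (-(u + y * Complex.I))‖ * (η * ‖Complex.exp (u + y * Complex.I)‖) := by gcongr
        _ = η * ‖Complex.exp (-(u + y * Complex.I)) * Complex.exp (u + y * Complex.I)‖ := by
          rw [norm_mul]; ring
        _ = η := by rw [← Complex.exp_add]; simp
    · rw [sub_zero, abs_of_pos (by positivity)]; ring
  have htot : ‖(2 * Real.pi) • fderiv ℝ F 0 1‖ ≤ 2 * Real.pi * η + 2 * Real.pi * (a * R) + 2 * Real.pi * (ε / R) := by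
    have e1 : (2 * Real.pi) • fderiv ℝ F 0 1 = -(A u - (2 * Real.pi) • fderiv ℝ F 0 1) - (A (Real.log R) - A u)
        + A (Real.log R) := by abel
    rw [e1]
    refine (norm_add_le _ _).trans (add_le_add ((norm_sub_le _ _).trans (add_le_add ?_ (hAdiff u huR))) hAR)
    rw [norm_neg]; exact hAu
  rw [norm_smul, Real.norm_of_nonneg (by positivity)] at htot
  have h2pi : 0 < 2 * Real.pi := by positivity
  have : 2 * Real.pi * ‖fderiv ℝ F 0 1‖ ≤ 2 * Real.pi * (ε / R + a * R + η) := by linarith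
  exact le_of_mul_le_mul_left this h2pi
end

noncomputable section
set_option linter.unusedSimpArgs false

def LocData (n : ℕ) (J : Cn n → (Cn n →L[ℝ] Cn n)) (p : Cn n) (r C : ℝ) : Prop :=
  0 < r ∧ 1 ≤ C ∧
  (∀ x ∈ ball p r, ∃ Q : Cn n →L[ℝ] Cn n, (∀ v, Q (J x v) = Complex.I • Q v) ∧
    (∀ v, ‖Q v‖ ≤ C * ‖v‖) ∧ (∀ v, ‖v‖ ≤ C * ‖Q v‖)) ∧
  (∀ x ∈ ball p r, ∀ y ∈ ball p r, ‖J x - J y‖ ≤ C * ‖x - y‖) ∧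
  (∀ x ∈ ball p r, ‖J x‖ ≤ C)

/-- differentiable solutions of the equation on a disc -/
def JSol (n : ℕ) (J : Cn n → (Cn n →L[ℝ] Cn n)) (U : Set (Cn n)) (D : Set ℂ) (f : ℂ → Cn n) : Prop :=
  (∀ z ∈ D, f z ∈ U) ∧ ∀ z ∈ D, DifferentiableAt ℝ f z ∧
      ∀ ξ : ℂ, fderiv ℝ f z (Complex.I * ξ) = J (f z) (fderiv ℝ f z ξ)

lemma local_est {n : ℕ} {J : Cn n → (Cn n →L[ℝ] Cn n)} {p : Cn n} {r C : ℝ} (hL : LocData n J p r C)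
    {f : ℂ → Cn n} {z₁ : ℂ} {δ R b ε : ℝ} (hR : 0 < R) (hRδ : R < δ) (hb : 0 ≤ b)
    (hf : JSol n J (ball p r) (ball z₁ δ) f) (hε : ∀ z ∈ ball z₁ δ, ‖f z - f z₁‖ ≤ ε)
    (hB : ∀ z ∈ ball z₁ δ, ‖fderiv ℝ f z‖ ≤ b) :
    ‖fderiv ℝ f z₁‖ ≤ 4 * C ^ 4 * (ε / R + b ^ 2 * R) := by
  obtain ⟨hr, hC, hQ, hLip, hJb⟩ := hL
  have hδ : 0 < δ := hR.trans hRδ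
  have h1 : z₁ ∈ ball z₁ δ := mem_ball_self hδ
  have hε0 : 0 ≤ ε := by simpa using hε z₁ h1
  obtain ⟨Q, hQJ, hQ1, hQ2⟩ := hQ _ (hf.1 z₁ h1)
  set F : ℂ → Cn n := fun ζ => Q (f (z₁ + ζ) - f z₁) with hF
  have hmem : ∀ ζ ∈ ball (0:ℂ) δ, z₁ + ζ ∈ ball z₁ δ := by
    intro ζ hζ; simpa using hζ
  have hFd : ∀ ζ ∈ ball (0:ℂ) δ, HasFDerivAt F (Q.comp (fderiv ℝ f (z₁ + ζ))) ζ := by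
    intro ζ hζ
    have h2 := (hf.2 _ (hmem ζ hζ)).1.hasFDerivAt
    have h3 : HasFDerivAt (fun ζ => f (z₁ + ζ)) (fderiv ℝ f (z₁ + ζ)) ζ := by
      have h := h2.comp ζ (f := fun ζ => z₁ + ζ) ((hasFDerivAt_id ζ).const_add z₁)
      rw [ContinuousLinearMap.comp_id] at h
      exact h
    exact Q.hasFDerivAt.comp ζ (h3.sub_const (f z₁))
  have hlip : ∀ z ∈ ball z₁ δ, ‖f z - f z₁‖ ≤ b * ‖z - z₁‖ := by
    intro z hz
    exact (convex_ball z₁ δ).norm_image_sub_le_of_norm_fderiv_le (𝕜 := ℝ) (fun x hx => (hf.2 x hx).1) hB h1 hz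
  have hc := core_est (F := F) (ρ := δ) (R := R) (a := C ^ 2 * b ^ 2) (ε := C * ε) hR hRδ (by positivity)
    (fun ζ hζ => (hFd ζ hζ).differentiableAt) (by simp [hF]) ?_ ?_
  rotate_left
  · intro ζ hζ
    refine (hQ1 _).trans ?_
    have := hε _ (hmem ζ hζ)
    gcongr
  · intro ζ hζ ξ
    rw [(hFd ζ hζ).fderiv]
    have hz := hmem ζ hζ
    simp only [ContinuousLinearMap.comp_apply]
    rw [(hf.2 _ hz).2 ξ, ← hQJ, ← map_sub]
    have e : J (f z₁) (fderiv ℝ f (z₁ + ζ) ξ) - J (f (z₁ + ζ)) (fderiv ℝ f (z₁ + ζ) ξ) =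
      (J (f z₁) - J (f (z₁ + ζ))) (fderiv ℝ f (z₁ + ζ) ξ) := by simp
    rw [e]
    have a1 : ‖J (f z₁) - J (f (z₁ + ζ))‖ ≤ C * (b * ‖ζ‖) := by
      refine (hLip _ (hf.1 _ h1) _ (hf.1 _ hz)).trans ?_
      have := hlip _ hz
      rw [norm_sub_rev]
      simp only [add_sub_cancel_left] at this
      gcongr
    have a2 : ‖fderiv ℝ f (z₁ + ζ) ξ‖ ≤ b * ‖ξ‖ :=
      ((fderiv ℝ f (z₁ + ζ)).le_opNorm ξ).trans (by have := hB _ hz; gcongr)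
    calc _ ≤ C * ‖(J (f z₁) - J (f (z₁ + ζ))) (fderiv ℝ f (z₁ + ζ) ξ)‖ := hQ1 _
      _ ≤ C * (‖J (f z₁) - J (f (z₁ + ζ))‖ * ‖fderiv ℝ f (z₁ + ζ) ξ‖) := by
          gcongr; exact ContinuousLinearMap.le_opNorm _ _
      _ ≤ C * ((C * (b * ‖ζ‖)) * (b * ‖ξ‖)) := by gcongr
      _ = _ := by ring
  rw [(hFd 0 (by simpa using hδ)).fderiv] at hc
  simp only [ContinuousLinearMap.comp_apply, add_zero] at hc
  have h3 := hQ2 (fderiv ℝ f z₁ 1)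
  have h4 : ‖fderiv ℝ f z₁‖ ≤ 2 * C * ‖fderiv ℝ f z₁ 1‖ := by
    refine ContinuousLinearMap.opNorm_le_bound _ (by positivity) fun ξ => ?_
    have e : ξ = ξ.re • (1:ℂ) + ξ.im • (Complex.I * 1) := by
      simp [Complex.re_add_im]
    conv_lhs => rw [e]
    rw [map_add, map_smul, map_smul, (hf.2 _ h1).2]
    have b1 : ‖J (f z₁) (fderiv ℝ f z₁ 1)‖ ≤ C * ‖fderiv ℝ f z₁ 1‖ :=
      (ContinuousLinearMap.le_opNorm _ _).trans (by have := hJb _ (hf.1 _ h1); gcongr)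
    have b2 := Complex.abs_re_le_norm ξ
    have b3 := Complex.abs_im_le_norm ξ
    calc _ ≤ ‖ξ.re • fderiv ℝ f z₁ 1‖ + ‖ξ.im • J (f z₁) (fderiv ℝ f z₁ 1)‖ := norm_add_le _ _
      _ ≤ ‖ξ‖ * (C * ‖fderiv ℝ f z₁ 1‖) + ‖ξ‖ * (C * ‖fderiv ℝ f z₁ 1‖) := by
          rw [norm_smul, norm_smul, Real.norm_eq_abs, Real.norm_eq_abs]
          gcongr
          nlinarith [norm_nonneg (fderiv ℝ f z₁ 1)]
      _ = _ := by ring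
  have hC0 : 0 < C := by linarith
  calc _ ≤ 2 * C * ‖fderiv ℝ f z₁ 1‖ := h4
    _ ≤ 2 * C * (C * (C * ε / R + C ^ 2 * b ^ 2 * R)) := by
        gcongr
        exact h3.trans (by gcongr)
    _ = 2 * C ^ 3 * (ε / R) + 2 * C ^ 4 * (b ^ 2 * R) := by ring
    _ ≤ 4 * C ^ 4 * (ε / R) + 4 * C ^ 4 * (b ^ 2 * R) := by
        have : C ^ 3 ≤ C ^ 4 := pow_le_pow_right₀ hC (by norm_num)
        have p3 : 0 ≤ C ^ 3 := by positivity
        gcongr <;> linarith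
    _ = _ := by ring

lemma grad_bdd {n : ℕ} {J : Cn n → (Cn n →L[ℝ] Cn n)} {p : Cn n} {r C : ℝ} (hL : LocData n J p r C)
    {f : ℂ → Cn n} {z₀ : ℂ} {ρ ε B : ℝ} (hρ : 0 < ρ)
    (hε0 : ε ≤ 1 / (256 * (4 * C ^ 4) ^ 2))
    (hf : JSol n J (ball p r) (ball z₀ ρ) f) (hε : ∀ z ∈ ball z₀ ρ, ‖f z - f z₀‖ ≤ ε)
    (hB : ∀ z ∈ ball z₀ ρ, ‖fderiv ℝ f z‖ ≤ B) :
    ‖fderiv ℝ f z₀‖ ≤ 32 * (4 * C ^ 4) * ε / ρ := by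
  have hC : 1 ≤ C := hL.2.1
  have h0 : z₀ ∈ ball z₀ ρ := mem_ball_self hρ
  have hεn : 0 ≤ ε := by simpa using hε z₀ h0
  have hBn : 0 ≤ B := (norm_nonneg _).trans (hB _ h0)
  set D := 4 * C ^ 4 with hD
  have hD0 : 0 < D := by positivity
  set S : Set ℝ := (fun z => (ρ - ‖z - z₀‖) * ‖fderiv ℝ f z‖) '' ball z₀ ρ with hS
  have hSb : BddAbove S := by
    refine ⟨ρ * B, ?_⟩
    rintro _ ⟨z, hz, rfl⟩
    have := hB z hz
    have h2 : ‖z - z₀‖ < ρ := by simpa [dist_eq_norm] using hz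
    have h3 := norm_nonneg (z - z₀)
    have h4 := norm_nonneg (fderiv ℝ f z)
    show (ρ - ‖z - z₀‖) * ‖fderiv ℝ f z‖ ≤ ρ * B
    apply mul_le_mul <;> linarith
  have hSn : S.Nonempty := ⟨_, z₀, h0, rfl⟩
  set M := sSup S with hM
  have hle : ∀ z ∈ ball z₀ ρ, (ρ - ‖z - z₀‖) * ‖fderiv ℝ f z‖ ≤ M := fun z hz =>
    le_csSup hSb ⟨z, hz, rfl⟩
  have hz0 := hle z₀ h0
  simp only [sub_self, norm_zero, sub_zero] at hz0
  suffices hMM : M ≤ 32 * D * ε by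
    rw [le_div_iff₀ hρ]; linarith
  by_cases hM0 : M ≤ 0
  · exact hM0.trans (by positivity)
  push Not at hM0
  obtain ⟨_, ⟨z₁, hz₁, rfl⟩, hlt⟩ := exists_lt_of_lt_csSup hSn (show M / 2 < M by linarith)
  simp only at hlt
  have hz1 : ‖z₁ - z₀‖ < ρ := by simpa [dist_eq_norm] using hz₁
  set δ := (ρ - ‖z₁ - z₀‖) / 2 with hδ
  have hδ0 : 0 < δ := by rw [hδ]; linarith
  have hsub : ball z₁ δ ⊆ ball z₀ ρ := by
    apply ball_subset_ball'
    rw [dist_eq_norm]; linarith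
  have hb : ∀ z ∈ ball z₁ δ, ‖fderiv ℝ f z‖ ≤ M / δ := by
    intro z hz
    have h1 := hle z (hsub hz)
    have h2 : ‖z - z₁‖ < δ := by simpa [dist_eq_norm] using hz
    have h3 : ‖z - z₀‖ ≤ ‖z - z₁‖ + ‖z₁ - z₀‖ := norm_sub_le_norm_sub_add_norm_sub _ _ _
    rw [le_div_iff₀ hδ0]
    nlinarith [norm_nonneg (fderiv ℝ f z)]
  have hosc : ∀ z ∈ ball z₁ δ, ‖f z - f z₁‖ ≤ 2 * ε := by
    intro z hz
    have h1 := hε z (hsub hz)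
    have h2 := hε z₁ hz₁
    have h3 := norm_sub_le_norm_sub_add_norm_sub (f z) (f z₀) (f z₁)
    rw [norm_sub_rev (f z₀)] at h3
    linarith
  have key : ∀ θ : ℝ, 0 < θ → θ < 1 → M / 4 ≤ D * (2 * ε / θ + M ^ 2 * θ) := by
    intro θ h1 h2
    have h3 := local_est hL (R := θ * δ) (δ := δ) (by positivity) (by nlinarith) (by positivity : 0 ≤ M / δ)
      ⟨fun z hz => hf.1 z (hsub hz), fun z hz => hf.2 z (hsub hz)⟩ hosc hb
    have h4 : M / 4 ≤ δ * ‖fderiv ℝ f z₁‖ := by rw [hδ]; linarith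
    refine h4.trans ((mul_le_mul_of_nonneg_left h3 hδ0.le).trans (le_of_eq ?_))
    rw [← hD]
    field_simp
  by_cases hMD : M ≤ 1 / (8 * D)
  · have h1 := key (1/2) (by norm_num) (by norm_num)
    rw [le_div_iff₀ (by positivity)] at hMD
    have h2 : D * (M ^ 2 * (1/2)) ≤ M / 16 := by nlinarith
    have h3 : D * (2 * ε / (1/2) + M ^ 2 * (1/2)) = 4 * D * ε + D * (M ^ 2 * (1/2)) := by ring
    rw [h3] at h1
    nlinarith
  · push Not at hMD
    exfalso
    rw [div_lt_iff₀ (by positivity)] at hMD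
    have h1 := key (1 / (16 * D * M)) (by positivity) (by rw [div_lt_one (by positivity)]; linarith)
    have h3 : D * (2 * ε / (1 / (16 * D * M)) + M ^ 2 * (1 / (16 * D * M))) = 32 * D ^ 2 * ε * M + M / 16 := by
      field_simp
      ring
    rw [h3] at h1
    rw [le_div_iff₀ (by positivity)] at hε0
    have : 32 * D ^ 2 * ε ≤ 1 / 8 := by nlinarith
    have h5 : 32 * D ^ 2 * ε * M ≤ 1/8 * M := by nlinarith
    linarith
end

noncomputable section
set_option linter.unusedSimpArgs false

lemma grad_locbdd {n : ℕ} {J : Cn n → (Cn n →L[ℝ] Cn n)} {p : Cn n} {r C : ℝ} (hL : LocData n J p r C)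
    {f : ℂ → Cn n} {z₀ : ℂ} {ρ ε : ℝ} (hρ : 0 < ρ)
    (hε0 : ε ≤ 1 / (256 * (4 * C ^ 4) ^ 2))
    (hf : JSol n J (ball p r) (ball z₀ ρ) f) (hε : ∀ z ∈ ball z₀ ρ, ‖f z - f z₀‖ ≤ ε)
    (hB : ∀ z ∈ ball z₀ ρ, ∃ s > 0, ∃ B, ∀ w ∈ ball z s, ‖fderiv ℝ f w‖ ≤ B) :
    ‖fderiv ℝ f z₀‖ ≤ 64 * (4 * C ^ 4) * ε / ρ := by
  have hsub : closedBall z₀ (ρ/2) ⊆ ball z₀ ρ := closedBall_subset_ball (by linarith)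
  obtain ⟨B, hBB⟩ : ∃ B, ∀ w ∈ closedBall z₀ (ρ/2), ‖fderiv ℝ f w‖ ≤ B := by
    apply (isCompact_closedBall z₀ (ρ/2)).induction_on (p := fun s => ∃ B, ∀ w ∈ s, ‖fderiv ℝ f w‖ ≤ B)
    · exact ⟨0, by simp⟩
    · rintro s t hst ⟨B, h⟩; exact ⟨B, fun w hw => h w (hst hw)⟩
    · rintro s t ⟨B, h⟩ ⟨B', h'⟩
      refine ⟨max B B', fun w hw => ?_⟩
      rcases hw with hw | hw
      · exact (h w hw).trans (le_max_left _ _)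
      · exact (h' w hw).trans (le_max_right _ _)
    · intro x hx
      obtain ⟨s, hs, B, h⟩ := hB x (hsub hx)
      exact ⟨ball x s, mem_nhdsWithin_of_mem_nhds (ball_mem_nhds x hs), B, h⟩
  have hs2 : ball z₀ (ρ/2) ⊆ ball z₀ ρ := ball_subset_ball (by linarith)
  have := grad_bdd hL (f := f) (z₀ := z₀) (ρ := ρ/2) (ε := ε) (B := B) (by linarith) hε0
    ⟨fun z hz => hf.1 z (hs2 hz), fun z hz => hf.2 z (hs2 hz)⟩ (fun z hz => hε z (hs2 hz))
    (fun z hz => hBB z (ball_subset_closedBall hz))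
  refine this.trans (le_of_eq ?_)
  field_simp; ring

lemma goursat {n : ℕ} {J : Cn n → (Cn n →L[ℝ] Cn n)} {p : Cn n} {r C : ℝ} (hL : LocData n J p r C)
    {f : ℂ → Cn n} {z₀ : ℂ} {ρ : ℝ}
    (hf : JSol n J (ball p r) (ball z₀ ρ) f) :
    ∀ z ∈ ball z₀ ρ, ∃ s > 0, ∃ B, ∀ w ∈ ball z s, ‖fderiv ℝ f w‖ ≤ B := by
  have hC : 1 ≤ C := hL.2.1
  set ε₀ := 1 / (256 * (4 * C ^ 4) ^ 2) with hε₀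
  have hε₀p : 0 < ε₀ := by positivity
  set G : Set ℂ := {z | ∃ s > 0, ∃ B, ∀ w ∈ ball z s, ‖fderiv ℝ f w‖ ≤ B} with hG
  have hGo : IsOpen G := by
    rw [Metric.isOpen_iff]
    rintro z ⟨s, hs, B, h⟩
    refine ⟨s / 2, by linarith, fun w hw => ⟨s/2, by linarith, B, fun w' hw' => h w' ?_⟩⟩
    rw [mem_ball] at *
    linarith [dist_triangle w' w z]
  set E : Set ℂ := ball z₀ ρ ∩ Gᶜ with hE
  by_contra hcon
  push Not at hcon
  obtain ⟨z, hz, hzG⟩ := hcon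
  have hzE : z ∈ E := ⟨hz, fun hh => by
    obtain ⟨s, hs, B, h⟩ := hh
    obtain ⟨w, hw, hw'⟩ := hzG s hs B
    exact absurd (h w hw) (not_le.2 hw')⟩
  have hlc : IsLocallyClosed E := isOpen_ball.isLocallyClosed.inter hGo.isClosed_compl.isLocallyClosed
  have : LocallyCompactSpace E := hlc.locallyCompactSpace
  have : Nonempty E := ⟨⟨z, hzE⟩⟩
  have hcont : Continuous (fun z : E => f z) := by
    rw [continuous_iff_continuousAt]
    intro x
    exact (hf.2 x x.2.1).1.continuousAt.comp continuous_subtype_val.continuousAt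
  set S : ℕ → Set E := fun k => {z : E | ∀ w ∈ ball z₀ ρ, dist w (z:ℂ) < 1 / ((k:ℝ)+1) →
    ‖f w - f z‖ ≤ ((k:ℝ)+1) * dist w (z:ℂ)} with hS
  have hSc : ∀ k, IsClosed (S k) := by
    intro k
    have : S k = ⋂ w ∈ ball z₀ ρ, ({z : E | 1 / ((k:ℝ)+1) ≤ dist w (z:ℂ)} ∪
        {z : E | ‖f w - f z‖ ≤ ((k:ℝ)+1) * dist w (z:ℂ)}) := by
      ext z
      simp only [hS, Set.mem_ofPred_eq, mem_iInter, mem_union]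
      refine forall₂_congr fun w hw => ?_
      rw [imp_iff_not_or, not_lt]
    rw [this]
    refine isClosed_biInter fun w hw => IsClosed.union ?_ ?_
    · exact isClosed_le continuous_const (by fun_prop)
    · exact isClosed_le (continuous_const.sub hcont).norm (by fun_prop)
  have hSU : ⋃ k, S k = univ := by
    rw [eq_univ_iff_forall]
    intro x
    have h1 := (hf.2 x x.2.1).1.hasFDerivAt.isBigO_sub
    obtain ⟨c, hc⟩ := h1.bound
    obtain ⟨δ, hδ, h2⟩ := Metric.eventually_nhds_iff.1 hc
    obtain ⟨k1, hk1⟩ := exists_nat_gt c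
    obtain ⟨k2, hk2⟩ := exists_nat_gt (1 / δ)
    rw [mem_iUnion]
    refine ⟨max k1 k2, fun w hw hd => ?_⟩
    have e1 : (k1:ℝ) ≤ ((max k1 k2 : ℕ) : ℝ) := by exact_mod_cast le_max_left _ _
    have e2 : (k2:ℝ) ≤ ((max k1 k2 : ℕ) : ℝ) := by exact_mod_cast le_max_right _ _
    have hlt : dist w (x:ℂ) < δ := by
      refine hd.trans ?_
      rw [div_lt_iff₀ (by positivity)]
      rw [div_lt_iff₀ hδ] at hk2
      nlinarith
    have := h2 hlt
    rw [← dist_eq_norm w] at this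
    exact this.trans (by gcongr; linarith)
  obtain ⟨k, z₁, hz₁⟩ := nonempty_interior_of_iUnion_of_closed hSc hSU
  obtain ⟨s₀, hs₀, hsub⟩ := Metric.isOpen_iff.1 isOpen_interior z₁ hz₁
  have hz₁b : (z₁:ℂ) ∈ ball z₀ ρ := z₁.2.1
  obtain ⟨s₁, hs₁, hsub₁⟩ := Metric.isOpen_iff.1 isOpen_ball (z₁:ℂ) hz₁b
  set κ : ℝ := (k:ℝ) + 1 with hκ
  have hκ0 : 0 < κ := by positivity
  obtain ⟨s, hs, hss0, hss1, hsκ, hsε⟩ : ∃ s : ℝ, 0 < s ∧ s ≤ s₀ ∧ s ≤ s₁ ∧ s ≤ 1 / κ ∧ s ≤ ε₀ / (5 * κ) :=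
    ⟨min (min s₀ s₁) (min (1/κ) (ε₀ / (5 * κ))), by positivity,
      (min_le_left _ _).trans (min_le_left _ _), (min_le_left _ _).trans (min_le_right _ _),
      (min_le_right _ _).trans (min_le_left _ _), (min_le_right _ _).trans (min_le_right _ _)⟩
  rw [le_div_iff₀ (by positivity)] at hsε
  have hES : ∀ x ∈ E, dist x (z₁:ℂ) < s → ∀ w ∈ ball z₀ ρ, dist w x < 1 / κ → ‖f w - f x‖ ≤ κ * dist w x := by
    intro x hx hd
    have : (⟨x, hx⟩ : E) ∈ S k := interior_subset (hsub (by
      rw [mem_ball]; exact lt_of_lt_of_le hd hss0))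
    exact this
  have hdom : ∀ w, dist w (z₁:ℂ) < s → w ∈ ball z₀ ρ := fun w hw => hsub₁ (by
    rw [mem_ball]; linarith)
  apply z₁.2.2
  refine ⟨s / 4, by linarith, max κ (64 * (4 * C ^ 4) * (5 * κ)), fun w hw => ?_⟩
  rw [mem_ball] at hw
  have hwd := hdom w (by linarith)
  by_cases hwE : w ∈ E
  · refine le_trans ?_ (le_max_left _ _)
    refine (hf.2 w hwd).1.hasFDerivAt.le_of_lip' hκ0.le ?_
    have h1 : ∀ᶠ x in 𝓝 w, dist x w < 1 / κ := Metric.ball_mem_nhds w (by positivity)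
    filter_upwards [h1, isOpen_ball.mem_nhds hwd] with x hx hx2
    rw [← dist_eq_norm x]
    exact hES w hwE (by linarith) x hx2 hx
  · refine le_trans ?_ (le_max_right _ _)
    have hwG : w ∈ G := by
      by_contra hh; exact hwE ⟨hwd, hh⟩
    have hEne : E.Nonempty := ⟨z, hzE⟩
    set d := infDist w E with hd
    have hdle : d ≤ dist w (z₁:ℂ) := infDist_le_dist_of_mem z₁.2
    have hd0 : 0 < d := by
      obtain ⟨t, ht, htG⟩ := Metric.isOpen_iff.1 hGo w hwG
      refine lt_of_lt_of_le ht ?_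
      rw [hd, le_infDist hEne]
      intro y hy
      by_contra hlt
      push Not at hlt
      exact hy.2 (htG (by rw [mem_ball, dist_comm]; exact hlt))
    obtain ⟨z₂, hz₂, hz₂d⟩ := (infDist_lt_iff hEne).1 (show infDist w E < 2 * d by rw [← hd]; linarith)
    have hz₂1 : dist z₂ (z₁:ℂ) < s := by
      have := dist_triangle z₂ w (z₁:ℂ)
      rw [dist_comm z₂ w] at this
      linarith
    have hL2 := hES z₂ hz₂ hz₂1
    have hball : ball w d ⊆ ball z₀ ρ := by
      intro x hx
      rw [mem_ball] at hx
      exact hdom x (by linarith [dist_triangle x w (z₁:ℂ)])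
    have hosc : ∀ x ∈ ball w d, ‖f x - f w‖ ≤ 5 * κ * d := by
      intro x hx
      have hx' := hx
      rw [mem_ball] at hx'
      have t1 := dist_triangle x w z₂
      have a1 := hL2 x (hball hx) (by linarith)
      have a2 := hL2 w hwd (by linarith)
      have a3 := norm_sub_le_norm_sub_add_norm_sub (f x) (f z₂) (f w)
      rw [norm_sub_rev (f z₂)] at a3
      nlinarith
    have := grad_locbdd hL (f := f) (z₀ := w) (ρ := d) (ε := 5 * κ * d) hd0 (by rw [← hε₀]; nlinarith)
      ⟨fun x hx => hf.1 x (hball hx), fun x hx => hf.2 x (hball hx)⟩ hosc ?_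
    · refine this.trans (le_of_eq ?_)
      field_simp
    · intro x hx
      by_contra hh
      have hxE : x ∈ E := ⟨hball hx, hh⟩
      have := infDist_le_dist_of_mem (x := w) hxE
      rw [mem_ball, dist_comm] at hx
      linarith

lemma grad_final {n : ℕ} {J : Cn n → (Cn n →L[ℝ] Cn n)} {p : Cn n} {r C : ℝ} (hL : LocData n J p r C) :
    ∃ r' > 0, ∃ N : ℝ, ∀ (f : ℂ → Cn n) (z₀ : ℂ) (ρ : ℝ), 0 < ρ →
      JSol n J (ball p r') (ball z₀ ρ) f → ‖fderiv ℝ f z₀‖ ≤ N / ρ := by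
  have hC : 1 ≤ C := hL.2.1
  set ε₀ := 1 / (256 * (4 * C ^ 4) ^ 2) with hε₀
  have hε₀p : 0 < ε₀ := by positivity
  refine ⟨min r (ε₀ / 2), lt_min hL.1 (by linarith), 64 * (4 * C ^ 4) * ε₀, fun f z₀ ρ hρ hf => ?_⟩
  have hf' : JSol n J (ball p r) (ball z₀ ρ) f :=
    ⟨fun z hz => ball_subset_ball (min_le_left _ _) (hf.1 z hz), hf.2⟩
  refine grad_locbdd hL hρ (ε := ε₀) le_rfl hf' ?_ (goursat hL hf')
  intro z hz
  have h1 := ball_subset_ball (min_le_right _ _) (hf.1 z hz)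
  have h2 := ball_subset_ball (min_le_right _ _) (hf.1 z₀ (mem_ball_self hρ))
  rw [mem_ball] at h1 h2
  rw [← dist_eq_norm]
  linarith [dist_triangle_right (f z) (f z₀) p]
end

noncomputable section
set_option linter.unusedSimpArgs false
set_option linter.unusedSectionVars false

section kernels
variable {E : Type*} [NormedAddCommGroup E] [NormedSpace ℝ E]
  {W : Type*} [NormedAddCommGroup W] [NormedSpace ℝ W]

def kA (G : ℂ → E →L[ℝ] W) (ε : ℝ) (h : ℂ → E) (x : ℂ) : W := ∫ s : ℂ, G s (h (x - ε • s))

def kD (G : ℂ → E →L[ℝ] W) (s : ℂ) : E →L[ℝ] (ℂ →L[ℝ] W) := (fderiv ℝ G s).flip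

def HB (h : ℂ → E) (M : ℝ) : Prop :=
  (∀ x, ‖h x‖ ≤ M) ∧ ∀ x y, ‖h x - h y‖ ≤ M * √‖x - y‖

lemma HB.cont {h : ℂ → E} {M : ℝ} (hh : HB h M) : Continuous h := by
  rw [continuous_iff_continuousAt]
  intro y
  rw [ContinuousAt, tendsto_iff_norm_sub_tendsto_zero]
  have h1 : Tendsto (fun x : ℂ => M * √‖x - y‖) (𝓝 y) (𝓝 0) := by
    have : Continuous (fun x : ℂ => M * √‖x - y‖) := by fun_prop
    simpa using this.tendsto y
  exact squeeze_zero (fun x => norm_nonneg _) (fun x => hh.2 x y) h1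

lemma HB.nonneg {h : ℂ → E} {M : ℝ} (hh : HB h M) : 0 ≤ M := (norm_nonneg _).trans (hh.1 0)

lemma kA_integrable {G : ℂ → E →L[ℝ] W} (hG : Continuous G) (hc : HasCompactSupport G) (ε : ℝ)
    {h : ℂ → E} (hh : Continuous h) (x : ℂ) :
    MeasureTheory.Integrable (fun s : ℂ => G s (h (x - ε • s))) := by
  refine Continuous.integrable_of_hasCompactSupport (by fun_prop) ?_
  refine hc.mono fun s hs => ?_
  rw [Function.mem_support] at *
  intro h0; apply hs; simp [h0]

lemma kD_contDiff {G : ℂ → E →L[ℝ] W} (hG : ContDiff ℝ (⊤ : ℕ∞) G) : ContDiff ℝ (⊤ : ℕ∞) (kD G) := by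
  have h1 : ContDiff ℝ (⊤ : ℕ∞) (fderiv ℝ G) := hG.fderiv_right (by simp)
  have h2 : ContDiff ℝ (⊤ : ℕ∞) (fun l : ℂ →L[ℝ] E →L[ℝ] W => l.flip) :=
    IsBoundedLinearMap.contDiff (IsBoundedLinearMap.mk ⟨fun _ _ => rfl, fun _ _ => rfl⟩
      ⟨1, one_pos, fun l => by rw [one_mul]; exact (ContinuousLinearMap.opNorm_flip l).le⟩)
  exact h2.comp h1

lemma kD_supp {G : ℂ → E →L[ℝ] W} (hc : HasCompactSupport G) : HasCompactSupport (kD G) := by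
  refine (hc.fderiv ℝ).mono fun s hs => ?_
  rw [Function.mem_support] at *
  intro h0; apply hs; simp [kD, h0]

variable [CompleteSpace W]

lemma kA_hasFDerivAt {G : ℂ → E →L[ℝ] W} (hG : ContDiff ℝ (⊤ : ℕ∞) G) (hc : HasCompactSupport G)
    {ε : ℝ} (hε : 0 < ε) {h : ℂ → E} (hh : Continuous h) (x : ℂ) :
    HasFDerivAt (kA G ε h) (ε⁻¹ • kA (kD G) ε h x) x := by
  set hε' : ℂ → E := fun t => h (ε • t) with hhe
  have hcont : Continuous hε' := by fun_prop
  set L : E →L[ℝ] (E →L[ℝ] W) →L[ℝ] W := ContinuousLinearMap.apply ℝ W with hL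
  have h1 := hc.hasFDerivAt_convolution_right (μ := MeasureTheory.volume) L
    (hcont.locallyIntegrable) (hG.of_le (by simp)) (ε⁻¹ • x)
  have e1 : kA G ε h = fun x => (MeasureTheory.convolution hε' G L MeasureTheory.volume) (ε⁻¹ • x) := by
    funext y
    rw [MeasureTheory.convolution_eq_swap]
    unfold kA
    congr 1
    funext s
    simp only [hL, hhe, ContinuousLinearMap.apply_apply, smul_sub, smul_inv_smul₀ hε.ne']
  have e2 : kA (kD G) ε h x =
      (MeasureTheory.convolution (𝕜 := ℝ) hε' (fderiv ℝ G) (L.precompR ℂ) MeasureTheory.volume) (ε⁻¹ • x) := by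
    rw [MeasureTheory.convolution_eq_swap]
    unfold kA
    congr 1
    funext s
    ext ξ
    simp only [hL, hhe, ContinuousLinearMap.apply_apply, smul_sub, smul_inv_smul₀ hε.ne', kD,
      ContinuousLinearMap.flip_apply, ContinuousLinearMap.precompR_apply]
    rfl
  rw [e1, e2]
  have h2 : HasFDerivAt (fun x : ℂ => ε⁻¹ • x) (ε⁻¹ • ContinuousLinearMap.id ℝ ℂ) x :=
    (hasFDerivAt_id x).const_smul ε⁻¹
  have h3 := h1.comp x h2
  rw [ContinuousLinearMap.comp_smul, ContinuousLinearMap.comp_id] at h3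
  exact h3

lemma kD_mean {G : ℂ → E →L[ℝ] W} (hG : ContDiff ℝ (⊤ : ℕ∞) G) (hc : HasCompactSupport G) (c : E) :
    ∫ s, kD G s c = 0 := by
  have h1 := kA_hasFDerivAt hG hc (ε := 1) one_pos (h := fun _ => c) continuous_const 0
  have h2 : HasFDerivAt (kA G 1 (fun _ => c)) (0 : ℂ →L[ℝ] W) 0 := by
    have : kA G 1 (fun _ => c) = fun _ => ∫ s, G s c := rfl
    rw [this]; exact hasFDerivAt_const _ _
  have := h1.unique h2
  simpa [kA] using this

lemma kA_bound1 {G : ℂ → E →L[ℝ] W} (hG : Continuous G) (hc : HasCompactSupport G) (ε : ℝ)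
    {h : ℂ → E} {M : ℝ} (hh : HB h M) (x : ℂ) : ‖kA G ε h x‖ ≤ (∫ s, ‖G s‖) * M := by
  have hi : MeasureTheory.Integrable (fun s => ‖G s‖) :=
    (hG.integrable_of_hasCompactSupport hc).norm
  rw [← MeasureTheory.integral_mul_const]
  refine MeasureTheory.norm_integral_le_of_norm_le (hi.mul_const M) (Eventually.of_forall fun s => ?_)
  exact ((G s).le_opNorm _).trans (by gcongr; exact hh.1 _)

lemma kA_bound3 {G : ℂ → E →L[ℝ] W} (hG : Continuous G) (hc : HasCompactSupport G)
    {ε : ℝ} (hε : 0 ≤ ε) {h : ℂ → E} {M : ℝ} (hh : HB h M) (x : ℂ) :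
    ‖kA G ε h x - ∫ s, G s (h x)‖ ≤ (∫ s, ‖G s‖ * √‖s‖) * M * √ε := by
  have hi : MeasureTheory.Integrable (fun s : ℂ => ‖G s‖ * √‖s‖) := by
    refine Continuous.integrable_of_hasCompactSupport (by fun_prop) ?_
    exact hc.norm.mul_right
  have e : kA G ε h x - ∫ s, G s (h x) = ∫ s, G s (h (x - ε • s) - h x) := by
    simp only [map_sub]
    rw [MeasureTheory.integral_sub (kA_integrable hG hc ε hh.cont x), kA]
    exact kA_integrable hG hc ε (h := fun _ => h x) continuous_const x
  rw [e, mul_assoc, ← MeasureTheory.integral_mul_const]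
  refine MeasureTheory.norm_integral_le_of_norm_le (hi.mul_const _) (Eventually.of_forall fun s => ?_)
  refine ((G s).le_opNorm _).trans ?_
  have h1 := hh.2 (x - ε • s) x
  have h2 : √‖x - ε • s - x‖ = √ε * √‖s‖ := by
    rw [← Real.sqrt_mul hε, show x - ε • s - x = -(ε • s) by abel, norm_neg, norm_smul, Real.norm_of_nonneg hε]
  rw [h2] at h1
  calc _ ≤ ‖G s‖ * (M * (√ε * √‖s‖)) := by gcongr
    _ = _ := by ring

lemma kA_bound2 {G : ℂ → E →L[ℝ] W} (hG : Continuous G) (hc : HasCompactSupport G)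
    (hm : ∀ c, ∫ s, G s c = 0) {ε : ℝ} (hε : 0 ≤ ε)
    {h : ℂ → E} {M : ℝ} (hh : HB h M) (x : ℂ) : ‖kA G ε h x‖ ≤ (∫ s, ‖G s‖ * √‖s‖) * M * √ε := by
  have := kA_bound3 hG hc hε hh x
  rwa [hm, sub_zero] at this

lemma kA_sub {G : ℂ → E →L[ℝ] W} (hG : Continuous G) (hc : HasCompactSupport G) (ε : ℝ)
    {h k : ℂ → E} (hh : Continuous h) (hk : Continuous k) (x : ℂ) :
    kA G ε (fun z => h z - k z) x = kA G ε h x - kA G ε k x := by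
  unfold kA
  simp only [map_sub]
  exact MeasureTheory.integral_sub (kA_integrable hG hc ε hh x) (kA_integrable hG hc ε hk x)

end kernels

lemma geo_aux (N : ℕ) : ∀ s : ℝ, 0 ≤ s → (1 ≤ s → ∑ j ∈ Finset.range N, min ((1/2:ℝ)^j) (2^j * s^2) ≤ 2) ∧
    (s ≤ 1 → ∑ j ∈ Finset.range N, min ((1/2:ℝ)^j) (2^j * s^2) ≤ 3 * s - s^2) := by
  induction N with
  | zero => intro s hs; simp; intro h; nlinarith
  | succ N ih =>
    intro s hs
    have e : ∑ j ∈ Finset.range (N+1), min ((1/2:ℝ)^j) (2^j * s^2) =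
        (1/2) * ∑ j ∈ Finset.range N, min ((1/2:ℝ)^j) (2^j * (2*s)^2) + min 1 (s^2) := by
      rw [Finset.sum_range_succ', Finset.mul_sum]
      congr 1
      · refine Finset.sum_congr rfl fun j _ => ?_
        rw [mul_min_of_nonneg _ _ (by norm_num : (0:ℝ) ≤ 1/2)]
        congr 1 <;> ring
      · simp
    rw [e]
    obtain ⟨h1, h2⟩ := ih (2*s) (by linarith)
    constructor
    · intro h
      have := h1 (by linarith)
      have := min_le_left 1 (s^2)
      linarith
    · intro h
      have := min_le_right 1 (s^2)
      rcases le_total 1 (2*s) with h3 | h3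
      · have := h1 h3
        nlinarith
      · have := h2 h3
        nlinarith

lemma geo_sum (N : ℕ) {s : ℝ} (hs : 0 ≤ s) :
    ∑ j ∈ Finset.range N, min ((1/2:ℝ)^j) (2^j * s^2) ≤ 3 * s := by
  obtain ⟨h1, h2⟩ := geo_aux N s hs
  rcases le_total 1 s with h | h
  · linarith [h1 h]
  · nlinarith [h2 h]
end

noncomputable section
set_option linter.unusedSimpArgs false
set_option linter.unusedSectionVars false

lemma exists_kernel : ∃ (K : ℂ → ℂ) (φ : ℂ → ℝ), ContDiff ℝ (⊤ : ℕ∞) K ∧ HasCompactSupport K ∧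
    Continuous φ ∧ HasCompactSupport φ ∧ (∀ z, ‖z‖ < 2 → φ z = 0) ∧ (∫ z, φ z) ≠ 0 ∧
    ∀ z, fderiv ℝ K z 1 + Complex.I * fderiv ℝ K z Complex.I = 2 * ((φ z - 16 * φ (4 * z) : ℝ) : ℂ) := by
  set c : ℝ → ℝ := fun s => Real.smoothTransition (5 - s) with hc
  have hcs : ContDiff ℝ (⊤ : ℕ∞) c := Real.smoothTransition.contDiff.comp (contDiff_const.sub contDiff_id)
  have c1 : ∀ s, s ≤ 4 → c s = 1 := fun s hs => Real.smoothTransition.one_of_one_le (by linarith)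
  have c0 : ∀ s, 5 ≤ s → c s = 0 := fun s hs => Real.smoothTransition.zero_of_nonpos (by linarith)
  have hcd : ∀ s, HasDerivAt c (deriv c s) s := fun s =>
    ((hcs.differentiable (by simp)) s).hasDerivAt
  have hd0 : ∀ s, s < 4 → deriv c s = 0 := fun s hs => by
    have : c =ᶠ[𝓝 s] fun _ => 1 := by
      filter_upwards [Iio_mem_nhds hs] with x hx using c1 x (le_of_lt hx)
    rw [this.deriv_eq]; simp
  have hd5 : ∀ s, 5 < s → deriv c s = 0 := fun s hs => by
    have : c =ᶠ[𝓝 s] fun _ => 0 := by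
      filter_upwards [Ioi_mem_nhds hs] with x hx using c0 x (le_of_lt hx)
    rw [this.deriv_eq]; simp
  have hdn : ∀ s, deriv c s ≤ 0 := fun s => by
    apply Antitone.deriv_nonpos
    intro a b hab
    exact Real.smoothTransition.monotone (by linarith)
  have hdc : Continuous (deriv c) := hcs.continuous_deriv (by simp)
  obtain ⟨s0, hs0, hs0'⟩ : ∃ s, 0 ≤ s ∧ deriv c s ≠ 0 := by
    by_contra hcon
    push Not at hcon
    obtain ⟨s, hs, he⟩ := exists_deriv_eq_slope c (show (4:ℝ) < 5 by norm_num)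
      hcs.continuous.continuousOn (fun x _ => (hcd x).differentiableAt.differentiableWithinAt)
    rw [hcon s (by linarith [hs.1]), c1 4 le_rfl, c0 5 le_rfl] at he
    norm_num at he
  set κ : ℝ → ℝ := fun s => (c s - c (16 * s)) / s with hκ
  have κ0 : ∀ s, s ≤ 1/4 → κ s = 0 := fun s hs => by
    simp only [hκ]; rw [c1 s (by linarith), c1 (16*s) (by linarith)]; simp
  have κ5 : ∀ s, 5 ≤ s → κ s = 0 := fun s hs => by
    simp only [hκ]; rw [c0 s (by linarith), c0 (16*s) (by linarith)]; simp
  have hκs : ContDiff ℝ (⊤ : ℕ∞) κ := by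
    rw [contDiff_iff_contDiffAt]
    intro s
    rcases lt_or_ge s (1/4) with h | h
    · have : κ =ᶠ[𝓝 s] fun _ => 0 := by
        filter_upwards [Iio_mem_nhds h] with x hx using κ0 x (le_of_lt hx)
      exact contDiffAt_const.congr_of_eventuallyEq this
    · refine ContDiffAt.div ?_ contDiffAt_id (by simp; linarith)
      exact hcs.contDiffAt.sub ((hcs.comp (contDiff_const.mul contDiff_id)).contDiffAt)
  have hκd : ∀ s, HasDerivAt κ (deriv κ s) s := fun s =>
    ((hκs.differentiable (by simp)) s).hasDerivAt
  have hκe : ∀ s, κ s + s * deriv κ s = deriv c s - 16 * deriv c (16 * s) := by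
    intro s
    have h1 : HasDerivAt (fun s => s * κ s) (1 * κ s + s * deriv κ s) s := (hasDerivAt_id s).mul (hκd s)
    have h2 : HasDerivAt (fun s => c s - c (16 * s)) (deriv c s - deriv c (16 * s) * (16 * 1)) s :=
      (hcd s).sub ((hcd (16 * s)).comp s ((hasDerivAt_id s).const_mul 16))
    have e : (fun s => s * κ s) = fun s => c s - c (16 * s) := by
      funext s
      by_cases hs : s = 0
      · subst hs; simp
      · simp only [hκ]; field_simp
    rw [e] at h1
    have := h1.unique h2
    linarith
  have hns : ContDiff ℝ (⊤ : ℕ∞) (fun z : ℂ => ‖z‖ ^ 2) := contDiff_norm_sq ℝ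
  set K : ℂ → ℂ := fun z => (starRingEnd ℂ z) * ((κ (‖z‖^2) : ℝ) : ℂ) with hK
  refine ⟨K, fun z => deriv c (‖z‖^2), ?_, ?_, ?_, ?_, ?_, ?_, ?_⟩
  · exact (Complex.conjCLE.contDiff).mul (Complex.ofRealCLM.contDiff.comp (hκs.comp hns))
  · refine HasCompactSupport.intro (isCompact_closedBall (0:ℂ) 3) fun z hz => ?_
    simp only [mem_closedBall, dist_zero_right, not_le] at hz
    simp only [hK]
    rw [κ5 _ (by nlinarith)]; simp
  · exact hdc.comp (by fun_prop)
  · refine HasCompactSupport.intro (isCompact_closedBall (0:ℂ) 3) fun z hz => ?_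
    simp only [mem_closedBall, dist_zero_right, not_le] at hz
    exact hd5 _ (by nlinarith)
  · intro z hz
    exact hd0 _ (by nlinarith [norm_nonneg z])
  · have h1 := Continuous.integral_pos_of_hasCompactSupport_nonneg_nonzero
      (μ := (MeasureTheory.volume : MeasureTheory.Measure ℂ)) (f := fun z : ℂ => - deriv c (‖z‖^2))
      (x := ((√s0 : ℝ) : ℂ)) ?_ ?_ ?_ ?_
    · rw [MeasureTheory.integral_neg] at h1
      linarith
    · exact (hdc.comp (by fun_prop)).neg
    · refine HasCompactSupport.intro (isCompact_closedBall (0:ℂ) 3) fun z hz => ?_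
      simp only [mem_closedBall, dist_zero_right, not_le] at hz
      rw [hd5 _ (by nlinarith), neg_zero]
    · intro z; simp only [Pi.zero_apply]; linarith [hdn (‖z‖^2)]
    · rw [Complex.norm_real, Real.norm_eq_abs, sq_abs, Real.sq_sqrt hs0]
      simpa using hs0'
  · intro z
    have hn : HasFDerivAt (fun z : ℂ => ‖z‖^2) (2 • (innerSL ℝ z)) z := (hasStrictFDerivAt_norm_sq z).hasFDerivAt
    have h1 : HasFDerivAt (fun z : ℂ => ((κ (‖z‖^2) : ℝ) : ℂ))
        (Complex.ofRealCLM.comp (deriv κ (‖z‖^2) • (2 • (innerSL ℝ z)))) z :=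
      Complex.ofRealCLM.hasFDerivAt.comp z ((hκd _).comp_hasFDerivAt z hn)
    have h2 : HasFDerivAt (fun z : ℂ => starRingEnd ℂ z) (Complex.conjCLE : ℂ →L[ℝ] ℂ) z :=
      Complex.conjCLE.hasFDerivAt
    have h3 := h2.mul h1
    rw [show fderiv ℝ K z = _ from h3.fderiv]
    have e1 : ‖4 * z‖^2 = 16 * ‖z‖^2 := by rw [norm_mul]; norm_num; ring
    beta_reduce
    rw [e1, ← hκe]
    simp only [ContinuousLinearMap.add_apply, ContinuousLinearMap.smul_apply, ContinuousLinearMap.comp_apply,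
      Complex.ofRealCLM_apply, innerSL_apply_apply, Complex.inner, smul_eq_mul, nsmul_eq_mul,
      ContinuousLinearEquiv.coe_coe, Complex.conjCLE_apply, map_one, Complex.conj_I, Complex.sq_norm]
    apply Complex.ext <;> simp [Complex.normSq_apply] <;> ring
end

noncomputable section
set_option linter.unusedSimpArgs false
set_option linter.unusedSectionVars false

lemma exists_kernel' : ∃ (K : ℂ → ℂ) (φ : ℂ → ℝ), ContDiff ℝ (⊤ : ℕ∞) K ∧ HasCompactSupport K ∧
    Continuous φ ∧ HasCompactSupport φ ∧ (∀ z, ‖z‖ < 2 → φ z = 0) ∧ (∫ z, φ z) = -1 ∧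
    ∀ z, fderiv ℝ K z 1 + Complex.I * fderiv ℝ K z Complex.I = 2 * ((φ z - 16 * φ (4 * z) : ℝ) : ℂ) := by
  obtain ⟨K, φ, h1, h2, h3, h4, h5, h6, h7⟩ := exists_kernel
  set a : ℝ := -(∫ z, φ z)⁻¹ with ha
  refine ⟨fun z => a • K z, fun z => a * φ z, h1.const_smul a, ?_, by fun_prop, ?_, ?_, ?_, ?_⟩
  · exact h2.smul_left (f := fun _ => a)
  · exact h4.mul_left (f := fun _ => a)
  · intro z hz; simp [h5 z hz]
  · rw [MeasureTheory.integral_const_mul, ha]; field_simp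
  · intro z
    have : fderiv ℝ (fun z => a • K z) z = a • fderiv ℝ K z :=
      fderiv_fun_const_smul ((h1.differentiable (by simp)) z) a
    rw [this]
    have := h7 z
    simp only [smul_apply, Complex.real_smul]
    push_cast at this ⊢
    linear_combination (a:ℂ) * this

structure TOp (E : Type*) [NormedAddCommGroup E] [NormedSpace ℝ E] [NormedSpace ℂ E] where
  C : ℝ
  T : (ℂ → E) → ℂ → E
  T' : (ℂ → E) → ℂ → (ℂ →L[ℝ] E)
  hC : 1 ≤ C
  hd : ∀ h M, HB h M → ∀ x, HasFDerivAt (T h) (T' h x) x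
  hb : ∀ h M, HB h M → ∀ x, ‖T' h x‖ ≤ C * M
  hH : ∀ h M, HB h M → ∀ x y, ‖T' h x - T' h y‖ ≤ C * M * √‖x - y‖
  hs : ∀ h M k N, HB h M → HB k N → ∀ x, T (fun z => h z - k z) x = T h x - T k x
  hs' : ∀ h M k N, HB h M → HB k N → ∀ x, T' (fun z => h z - k z) x = T' h x - T' k x
  hcr : ∀ h M, HB h M → (∀ z, 1 ≤ ‖z‖ → h z = 0) → ∀ x, ‖x‖ < 1 →
    T' h x 1 + Complex.I • T' h x Complex.I = (2:ℝ) • h x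

section
variable {E : Type*} [NormedAddCommGroup E] [NormedSpace ℝ E] [NormedSpace ℂ E] [IsScalarTower ℝ ℂ E]
  [CompleteSpace E]

lemma sqrt_quarter (j : ℕ) : √((1/4:ℝ)^j) = (1/2)^j := by
  rw [show (1/4:ℝ) = (1/2)^2 by norm_num, ← pow_mul, mul_comm, pow_mul, Real.sqrt_sq (by positivity)]

lemma sum_lim {W : Type*} [NormedAddCommGroup W] {f : ℕ → W} (hf : Summable f) {B : ℝ}
    (h : ∀ N, ‖∑ j ∈ Finset.range N, f j‖ ≤ B) : ‖∑' j, f j‖ ≤ B :=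
  le_of_tendsto hf.hasSum.tendsto_sum_nat.norm (Eventually.of_forall h)

lemma cr_step {K : ℂ → ℂ} {φ : ℂ → ℝ} (hK : ContDiff ℝ (⊤ : ℕ∞) K) (hKc : HasCompactSupport K)
    (hφ : Continuous φ) (hφc : HasCompactSupport φ)
    (he : ∀ z, fderiv ℝ K z 1 + Complex.I * fderiv ℝ K z Complex.I = 2 * ((φ z - 16 * φ (4 * z) : ℝ) : ℂ))
    {G : ℂ → E →L[ℝ] E} (hG : ∀ s e, G s e = K s • e) (hGs : ContDiff ℝ (⊤ : ℕ∞) G) (hGc : HasCompactSupport G)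
    {Gφ : ℂ → E →L[ℝ] E} (hGφ : ∀ s e, Gφ s e = φ s • e) {h : ℂ → E} (hh : Continuous h) (ε : ℝ) (x : ℂ) :
    kA (kD G) ε h x 1 + Complex.I • kA (kD G) ε h x Complex.I =
      (2:ℝ) • (kA Gφ ε h x - kA Gφ (ε / 4) h x) := by
  have hev : ∀ ξ, kA (kD G) ε h x ξ = ∫ s, fderiv ℝ K s ξ • h (x - ε • s) := by
    intro ξ
    rw [kA, ContinuousLinearMap.integral_apply (kA_integrable (kD_contDiff hGs).continuous (kD_supp hGc) ε hh x)]
    congr 1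
    funext s
    have h1 : HasFDerivAt (fun s' => G s' (h (x - ε • s)))
        ((ContinuousLinearMap.apply ℝ E (h (x - ε • s))).comp (fderiv ℝ G s)) s :=
      (ContinuousLinearMap.apply ℝ E (h (x - ε • s))).hasFDerivAt.comp s
        ((hGs.differentiable (by simp)) s).hasFDerivAt
    have h2 : HasFDerivAt (fun s' => G s' (h (x - ε • s)))
        ((fderiv ℝ K s).smulRight (h (x - ε • s))) s := by
      simp only [hG]
      exact ((hK.differentiable (by simp)) s).hasFDerivAt.smul_const _
    have h3 := congrArg (fun l : ℂ →L[ℝ] E => l ξ) (h1.unique h2)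
    exact h3
  have hint : ∀ {c : ℂ → ℂ}, Continuous c → HasCompactSupport c →
      MeasureTheory.Integrable (fun s => c s • h (x - ε • s)) := by
    intro c hc hcc
    refine Continuous.integrable_of_hasCompactSupport (by fun_prop) ?_
    exact hcc.smul_right
  have hint' : ∀ {c : ℂ → ℝ}, Continuous c → HasCompactSupport c →
      MeasureTheory.Integrable (fun s => c s • h (x - ε • s)) := by
    intro c hc hcc
    refine Continuous.integrable_of_hasCompactSupport (by fun_prop) ?_
    exact hcc.smul_right
  have hDc : ∀ ξ, Continuous (fun s => fderiv ℝ K s ξ) := fun ξ => by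
    have := hK.continuous_fderiv (by simp)
    fun_prop
  have hDs : ∀ ξ, HasCompactSupport (fun s => fderiv ℝ K s ξ) := fun ξ => hKc.fderiv_apply ℝ ξ
  have hint2 : MeasureTheory.Integrable (fun s => Complex.I • fderiv ℝ K s Complex.I • h (x - ε • s)) :=
    (hint (hDc Complex.I) (hDs Complex.I)).smul Complex.I
  rw [hev, hev, ← MeasureTheory.integral_smul, ← MeasureTheory.integral_add (hint (hDc 1) (hDs 1)) hint2]
  have e1 : ∀ s, fderiv ℝ K s 1 • h (x - ε • s) + Complex.I • fderiv ℝ K s Complex.I • h (x - ε • s) =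
      (2:ℝ) • (φ s • h (x - ε • s) - (16 * φ (4 * s)) • h (x - ε • s)) := by
    intro s
    rw [smul_smul, ← add_smul, he, ← sub_smul, smul_smul, ← algebraMap_smul ℂ ((2:ℝ) * _)]
    congr 1
    simp
  have h4s : Continuous (fun s => φ (4 * s)) := by fun_prop
  have h4c : HasCompactSupport (fun s : ℂ => 16 * φ (4 * s)) := by
    have : HasCompactSupport (fun s : ℂ => φ ((4:ℝ) • s)) := hφc.comp_smul (by norm_num)
    have e : (fun s : ℂ => 16 * φ (4 * s)) = (fun _ => (16:ℝ)) * (fun s : ℂ => φ ((4:ℝ) • s)) := by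
      funext s; simp
    rw [e]
    exact this.mul_left
  simp only [e1]
  rw [MeasureTheory.integral_smul, MeasureTheory.integral_sub (hint' hφ hφc) (hint' (by fun_prop) h4c)]
  congr 2
  · simp only [kA, hGφ]
  · simp only [kA, hGφ]
    have := MeasureTheory.Measure.integral_comp_smul (MeasureTheory.volume : MeasureTheory.Measure ℂ)
      (fun s : ℂ => φ s • h (x - (ε / 4) • s)) (4:ℝ)
    have e2 : ∀ s : ℂ, (16 * φ (4 * s)) • h (x - ε • s) =
        (16:ℝ) • (φ ((4:ℝ) • s) • h (x - (ε / 4) • (4:ℝ) • s)) := by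
      intro s
      rw [smul_smul, smul_smul]
      congr 3
      · simp
    simp only [e2]
    rw [MeasureTheory.integral_smul, this, Complex.finrank_real_complex, smul_smul]
    norm_num

set_option maxHeartbeats 2000000 in
lemma exists_TOp : Nonempty (TOp E) := by
  obtain ⟨K, φ, hK, hKc, hφ, hφc, hφ0, hφ1, he⟩ := exists_kernel'
  set G : ℂ → E →L[ℝ] E := fun s => (ContinuousLinearMap.lsmul ℝ ℂ : ℂ →L[ℝ] E →L[ℝ] E) (K s) with hGdef
  have hG : ∀ s e, G s e = K s • e := fun s e => rfl
  have hGs : ContDiff ℝ (⊤ : ℕ∞) G :=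
    (ContinuousLinearMap.lsmul ℝ ℂ : ℂ →L[ℝ] E →L[ℝ] E).contDiff.comp hK
  have hGc : HasCompactSupport G := by
    refine hKc.mono fun s hs => ?_
    rw [Function.mem_support] at *
    intro h0; apply hs; simp only [hGdef, h0, map_zero]
  set Gφ : ℂ → E →L[ℝ] E := fun s => φ s • ContinuousLinearMap.id ℝ E with hGφdef
  have hGφ : ∀ s e, Gφ s e = φ s • e := fun s e => rfl
  have hGφs : Continuous Gφ := by fun_prop
  have hGφc : HasCompactSupport Gφ := hφc.smul_right
  have hD1 := kD_contDiff hGs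
  have hD1c := kD_supp hGc
  have hD2 := kD_contDiff hD1
  have hD2c := kD_supp hD1c
  set C0 := ∫ s, ‖G s‖
  set C1 := ∫ s, ‖kD G s‖ * √‖s‖
  set C2 := ∫ s, ‖kD (kD G) s‖ * √‖s‖
  set Cφ := ∫ s, ‖Gφ s‖ * √‖s‖
  have hC1 : 0 ≤ C1 := MeasureTheory.integral_nonneg fun s => by positivity
  have hC2 : 0 ≤ C2 := MeasureTheory.integral_nonneg fun s => by positivity
  have hε : ∀ j : ℕ, 0 < (1/4:ℝ)^j := fun j => by positivity
  have b0 : ∀ h M, HB h M → ∀ j x, ‖(1/4:ℝ)^j • kA G ((1/4)^j) h x‖ ≤ C0 * M * (1/4)^j := by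
    intro h M hh j x
    rw [norm_smul, Real.norm_of_nonneg (hε j).le, mul_comm]
    have := kA_bound1 hGs.continuous hGc ((1/4)^j) hh x
    gcongr
  have b1 : ∀ h M, HB h M → ∀ j x, ‖kA (kD G) ((1/4)^j) h x‖ ≤ C1 * M * (1/2)^j := by
    intro h M hh j x
    rw [← sqrt_quarter]
    exact kA_bound2 hD1.continuous hD1c (kD_mean hGs hGc) (hε j).le hh x
  have b2 : ∀ h M, HB h M → ∀ j x y, ‖kA (kD G) ((1/4)^j) h x - kA (kD G) ((1/4)^j) h y‖ ≤
      C2 * M * 2^j * ‖x - y‖ := by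
    intro h M hh j x y
    refine Convex.norm_image_sub_le_of_norm_hasFDerivWithin_le (𝕜 := ℝ) (s := univ)
      (fun z _ => (kA_hasFDerivAt hD1 hD1c (hε j) hh.cont z).hasFDerivWithinAt) ?_ convex_univ (mem_univ _) (mem_univ _)
    intro z _
    rw [norm_smul, norm_inv, Real.norm_of_nonneg (hε j).le]
    have := kA_bound2 hD2.continuous hD2c (kD_mean hD1 hD1c) (hε j).le hh z
    rw [sqrt_quarter] at this
    calc _ ≤ ((1/4:ℝ)^j)⁻¹ * (C2 * M * (1/2)^j) := by gcongr
      _ = C2 * M * (((1/4:ℝ)^j)⁻¹ * (1/2)^j) := by ring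
      _ = _ := by
        rw [← inv_pow, ← mul_pow]; norm_num
  have s0 : ∀ h M, HB h M → ∀ x, Summable fun j : ℕ => (1/4:ℝ)^j • kA G ((1/4)^j) h x := by
    intro h M hh x
    refine Summable.of_norm_bounded (g := fun j => C0 * M * (1/4)^j) ?_ (fun j => b0 h M hh j x)
    exact (summable_geometric_of_lt_one (by norm_num) (by norm_num)).mul_left _
  have sg : ∀ c : ℝ, Summable (fun j : ℕ => c * (1/2)^j) := fun c =>
    (summable_geometric_of_lt_one (by norm_num) (by norm_num)).mul_left _
  have s1 : ∀ h M, HB h M → ∀ x, Summable fun j : ℕ => kA (kD G) ((1/4)^j) h x := by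
    intro h M hh x
    exact Summable.of_norm_bounded (g := fun j => C1 * M * (1/2)^j) (sg _) (fun j => b1 h M hh j x)
  refine ⟨⟨1 + 6 * (C1 + C2), fun h x => ∑' j : ℕ, (1/4:ℝ)^j • kA G ((1/4)^j) h x,
    fun h x => ∑' j : ℕ, kA (kD G) ((1/4)^j) h x, by linarith, ?_, ?_, ?_, ?_, ?_, ?_⟩⟩
  · intro h M hh x
    refine hasFDerivAt_tsum (sg (C1 * M)) (fun j x => ?_) (b1 h M hh) (s0 h M hh 0) x
    have := (kA_hasFDerivAt hGs hGc (hε j) hh.cont x).const_smul ((1/4:ℝ)^j)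
    rw [smul_smul, mul_inv_cancel₀ (hε j).ne', one_smul] at this
    exact this
  · intro h M hh x
    have hM := hh.nonneg
    have h1 := tsum_of_norm_bounded ((hasSum_geometric_of_lt_one (r := (1/2:ℝ)) (by norm_num) (by norm_num)).mul_left
      (C1 * M)) (fun j => b1 h M hh j x)
    refine h1.trans ?_
    norm_num
    nlinarith [mul_nonneg hC1 hM, mul_nonneg hC2 hM]
  · intro h M hh x y
    have hM := hh.nonneg
    rw [← (s1 h M hh x).tsum_sub (s1 h M hh y)]
    refine sum_lim ((s1 h M hh x).sub (s1 h M hh y)) fun N => ?_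
    set s := √‖x - y‖ with hs
    have hs2 : ‖x - y‖ = s ^ 2 := (Real.sq_sqrt (norm_nonneg _)).symm
    have hs0 : 0 ≤ s := Real.sqrt_nonneg _
    have hterm : ∀ j ∈ Finset.range N, ‖kA (kD G) ((1/4)^j) h x - kA (kD G) ((1/4)^j) h y‖ ≤
        (2 * (C1 + C2) * M) * min ((1/2:ℝ)^j) (2^j * s^2) := by
      intro j _
      rw [mul_min_of_nonneg _ _ (by positivity)]
      refine le_min ?_ ?_
      · refine (norm_sub_le _ _).trans ?_
        have := b1 h M hh j x
        have := b1 h M hh j y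
        have : 0 ≤ C2 * M * (1/2)^j := by positivity
        linarith
      · refine (b2 h M hh j x y).trans ?_
        rw [hs2]
        have : 0 ≤ C2 * M * (2^j * s^2) := by positivity
        have : 0 ≤ C1 * M * (2^j * s^2) := by positivity
        linarith
    refine (norm_sum_le_of_le _ hterm).trans ?_
    rw [← Finset.mul_sum]
    have hg := geo_sum N hs0
    calc _ ≤ (2 * (C1 + C2) * M) * (3 * s) := by gcongr
      _ ≤ _ := by nlinarith [mul_nonneg hM hs0]
  · intro h M k N hh hk x
    rw [← (s0 h M hh x).tsum_sub (s0 k N hk x)]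
    congr 1; funext j
    rw [kA_sub hGs.continuous hGc _ hh.cont hk.cont, smul_sub]
  · intro h M k N hh hk x
    rw [← (s1 h M hh x).tsum_sub (s1 k N hk x)]
    congr 1; funext j
    rw [kA_sub hD1.continuous hD1c _ hh.cont hk.cont]
  · intro h M hh hsupp x hx
    have hS := (s1 h M hh x).hasSum
    have hS1 : Tendsto (fun N => (∑ j ∈ Finset.range N, kA (kD G) ((1/4)^j) h x) 1 +
        Complex.I • (∑ j ∈ Finset.range N, kA (kD G) ((1/4)^j) h x) Complex.I) atTop
        (𝓝 ((∑' j : ℕ, kA (kD G) ((1/4)^j) h x) 1 +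
          Complex.I • (∑' j : ℕ, kA (kD G) ((1/4)^j) h x) Complex.I)) := by
      have hcont : Continuous (fun l : ℂ →L[ℝ] E => l 1 + Complex.I • l Complex.I) := by fun_prop
      exact (hcont.tendsto _).comp hS.tendsto_sum_nat
    have hpart : ∀ N, (∑ j ∈ Finset.range N, kA (kD G) ((1/4)^j) h x) 1 +
        Complex.I • (∑ j ∈ Finset.range N, kA (kD G) ((1/4)^j) h x) Complex.I =
        (2:ℝ) • (kA Gφ ((1/4)^0) h x - kA Gφ ((1/4)^N) h x) := by
      intro N
      rw [← Finset.sum_range_sub' (fun j => kA Gφ ((1/4)^j) h x), Finset.smul_sum, sum_apply,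
        sum_apply, Finset.smul_sum, ← Finset.sum_add_distrib]
      refine Finset.sum_congr rfl fun j _ => ?_
      rw [cr_step hK hKc hφ hφc he hG hGs hGc hGφ hh.cont, pow_succ, mul_one_div]
    simp only [hpart] at hS1
    have hz : kA Gφ ((1/4)^0) h x = 0 := by
      unfold kA
      rw [← MeasureTheory.integral_zero ℂ E]
      congr 1
      funext s
      rw [hGφ]
      rcases lt_or_ge ‖s‖ 2 with h2 | h2
      · rw [hφ0 s h2, zero_smul]
      · rw [hsupp, smul_zero]
        have := norm_sub_norm_le s x
        rw [norm_sub_rev] at this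
        simp only [pow_zero, one_smul]
        linarith
    have hm : ∫ s, Gφ s (h x) = - h x := by
      simp only [hGφ]
      rw [integral_smul_const, hφ1, neg_one_smul]
    have hlim : Tendsto (fun N : ℕ => kA Gφ ((1/4)^N) h x) atTop (𝓝 (- h x)) := by
      rw [tendsto_iff_norm_sub_tendsto_zero]
      refine squeeze_zero (fun _ => norm_nonneg _) (g := fun N : ℕ => Cφ * M * (1/2)^N) (fun N => ?_) ?_
      · rw [← hm, ← sqrt_quarter]
        exact kA_bound3 hGφs hGφc (hε N).le hh x
      · have := (tendsto_pow_atTop_nhds_zero_of_lt_one (r := (1/2:ℝ)) (by norm_num) (by norm_num)).const_mul (Cφ * M)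
        simpa using this
    have hlim2 := (hlim.const_sub (kA Gφ ((1/4)^0) h x)).const_smul (2:ℝ)
    rw [tendsto_nhds_unique hS1 hlim2, hz]
    simp
end
end

noncomputable section
set_option linter.unusedSimpArgs false
set_option linter.unusedSectionVars false

def HBb {E : Type*} [NormedAddCommGroup E] (g : ℂ → E) (M : ℝ) : Prop :=
  (∀ x ∈ ball (0:ℂ) 1, ‖g x‖ ≤ M) ∧ ∀ x ∈ ball (0:ℂ) 1, ∀ y ∈ ball (0:ℂ) 1, ‖g x - g y‖ ≤ M * √‖x - y‖

lemma HBb.nonneg {E : Type*} [NormedAddCommGroup E] {g : ℂ → E} {M : ℝ} (hg : HBb g M) : 0 ≤ M :=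
  (norm_nonneg _).trans (hg.1 0 (by simp))

lemma HBb.mono {E : Type*} [NormedAddCommGroup E] {g : ℂ → E} {M N : ℝ} (hg : HBb g M) (h : M ≤ N) :
    HBb g N :=
  ⟨fun x hx => (hg.1 x hx).trans h, fun x hx y hy => (hg.2 x hx y hy).trans (by gcongr)⟩

lemma HBb.add {E : Type*} [NormedAddCommGroup E] {f g : ℂ → E} {M N : ℝ} (hf : HBb f M) (hg : HBb g N) :
    HBb (fun z => f z + g z) (M + N) := by
  refine ⟨fun x hx => (norm_add_le _ _).trans (add_le_add (hf.1 x hx) (hg.1 x hx)), fun x hx y hy => ?_⟩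
  rw [add_sub_add_comm, add_mul]
  exact (norm_add_le _ _).trans (add_le_add (hf.2 x hx y hy) (hg.2 x hx y hy))

lemma HB.mono {E : Type*} [NormedAddCommGroup E] {g : ℂ → E} {M N : ℝ} (hg : HB g M) (h : M ≤ N) :
    HB g N :=
  ⟨fun x => (hg.1 x).trans h, fun x y => (hg.2 x y).trans (by gcongr)⟩

def cutη (z : ℂ) : ℝ := max 0 (min 1 (2 - 2 * ‖z‖))

lemma cutη_one {z : ℂ} (h : ‖z‖ ≤ 1/2) : cutη z = 1 := by
  unfold cutη; rw [min_eq_left (by linarith), max_eq_right (by norm_num)]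

lemma cutη_zero {z : ℂ} (h : 1 ≤ ‖z‖) : cutη z = 0 := by
  unfold cutη; rw [max_eq_left]; exact (min_le_right _ _).trans (by linarith)

lemma cutη_bd (z : ℂ) : 0 ≤ cutη z ∧ cutη z ≤ 1 :=
  ⟨le_max_left _ _, max_le (by norm_num) (min_le_left _ _)⟩

lemma sqrt_aux {d a : ℝ} (hd : 0 ≤ d) (h1 : a ≤ 2 * d) (h2 : a ≤ 1) : a ≤ 2 * √d := by
  have h3 := Real.sq_sqrt hd
  have h4 := Real.sqrt_nonneg d
  rcases le_total (√d) 1 with h | h <;> nlinarith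

lemma cutη_hold (x y : ℂ) : |cutη x - cutη y| ≤ 2 * √‖x - y‖ := by
  refine sqrt_aux (norm_nonneg _) ?_ ?_
  · have h1 : |‖x‖ - ‖y‖| ≤ ‖x - y‖ := abs_norm_sub_norm_le x y
    rw [abs_le] at *
    unfold cutη
    rcases max_cases 0 (min 1 (2 - 2 * ‖x‖)) with h | h <;>
    rcases max_cases 0 (min 1 (2 - 2 * ‖y‖)) with h' | h' <;>
    rcases min_cases 1 (2 - 2 * ‖x‖) with h2 | h2 <;>
    rcases min_cases 1 (2 - 2 * ‖y‖) with h3 | h3 <;> constructor <;> linarith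
  · have := cutη_bd x
    have := cutη_bd y
    rw [abs_le]; constructor <;> linarith

section
variable {E : Type*} [NormedAddCommGroup E] [NormedSpace ℝ E]

lemma HBb.app {β : ℂ → E →L[ℝ] E} {g : ℂ → E} {A B : ℝ} (hβ : HBb β A) (hg : HBb g B) :
    HBb (fun z => β z (g z)) (2 * A * B) := by
  have hA := hβ.nonneg
  have hB := hg.nonneg
  refine ⟨fun x hx => ?_, fun x hx y hy => ?_⟩
  · refine ((β x).le_opNorm _).trans ?_
    have := hβ.1 x hx
    have := hg.1 x hx
    calc _ ≤ A * B := by gcongr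
      _ ≤ _ := by nlinarith [mul_nonneg hA hB]
  · have e : β x (g x) - β y (g y) = (β x - β y) (g x) + β y (g x - g y) := by simp
    rw [e]
    refine (norm_add_le _ _).trans ?_
    have h1 := ((β x - β y).le_opNorm (g x))
    have h2 := (β y).le_opNorm (g x - g y)
    have := hβ.1 y hy
    have := hg.1 x hx
    have := hβ.2 x hx y hy
    have := hg.2 x hx y hy
    calc _ ≤ (A * √‖x - y‖) * B + A * (B * √‖x - y‖) := by
          refine add_le_add (h1.trans ?_) (h2.trans ?_) <;> gcongr
      _ = _ := by ring

lemma HBb.cut {F : ℂ → E} {B : ℝ} (hF : HBb F B) : HB (fun z => cutη z • F z) (3 * B) := by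
  have hB := hF.nonneg
  have key : ∀ x ∈ ball (0:ℂ) 1, ∀ y, ‖cutη x • F x - cutη y • F y‖ ≤ 3 * B * √‖x - y‖ := by
    intro x hx y
    have h0 := cutη_hold x y
    by_cases hy : y ∈ ball (0:ℂ) 1
    · have e : cutη x • F x - cutη y • F y = (cutη x - cutη y) • F x + cutη y • (F x - F y) := by
        rw [sub_smul, smul_sub]; abel
      rw [e]
      refine (norm_add_le _ _).trans ?_
      rw [norm_smul, norm_smul, Real.norm_eq_abs, Real.norm_of_nonneg (cutη_bd y).1]
      have := hF.1 x hx
      have := hF.2 x hx y hy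
      have h2 := (cutη_bd y).2
      calc _ ≤ (2 * √‖x - y‖) * B + 1 * (B * √‖x - y‖) := by gcongr
        _ = _ := by ring
    · have : cutη y = 0 := cutη_zero (by simpa using hy)
      rw [this] at h0 ⊢
      rw [zero_smul, sub_zero, norm_smul, Real.norm_eq_abs]
      rw [sub_zero] at h0
      have := hF.1 x hx
      calc _ ≤ (2 * √‖x - y‖) * B := by gcongr
        _ ≤ _ := by nlinarith [mul_nonneg hB (Real.sqrt_nonneg ‖x - y‖)]
  refine ⟨fun x => ?_, fun x y => ?_⟩
  · by_cases hx : x ∈ ball (0:ℂ) 1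
    · rw [norm_smul, Real.norm_of_nonneg (cutη_bd x).1]
      have := hF.1 x hx
      have := (cutη_bd x).2
      calc _ ≤ 1 * B := by gcongr
        _ ≤ _ := by linarith
    · beta_reduce
      rw [cutη_zero (by simpa using hx), zero_smul, norm_zero]; positivity
  · by_cases hx : x ∈ ball (0:ℂ) 1
    · exact key x hx y
    · by_cases hy : y ∈ ball (0:ℂ) 1
      · rw [norm_sub_rev, norm_sub_rev x]; exact key y hy x
      · beta_reduce
        rw [cutη_zero (by simpa using hx), cutη_zero (by simpa using hy)]
        simp; positivity

/-- assumptions on the nonlinearity -/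
structure BData (b : E → E →L[ℝ] E) (L : ℝ) : Prop where
  hL : 1 ≤ L
  h0 : b 0 = 0
  h1 : ∀ x y, ‖b x - b y‖ ≤ L * ‖x - y‖
  h2 : ∀ a a' d, ‖(b (a + d) - b a) - (b (a' + d) - b a')‖ ≤ L * ‖d‖ * ‖a - a'‖

lemma HBb.bcomp {b : E → E →L[ℝ] E} {L : ℝ} (hb : BData b L) {u : ℂ → E} {A : ℝ} (hu : HBb u A) :
    HBb (fun z => b (u z)) (L * A) := by
  have hL := hb.hL
  refine ⟨fun x hx => ?_, fun x hx y hy => ?_⟩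
  · have h := hb.h1 (u x) 0
    rw [hb.h0, sub_zero, sub_zero] at h
    exact h.trans (by have := hu.1 x hx; gcongr)
  · refine (hb.h1 _ _).trans ?_
    rw [mul_assoc]
    have := hu.2 x hx y hy
    gcongr

lemma HBb.bdiff {b : E → E →L[ℝ] E} {L : ℝ} (hb : BData b L) {u k : ℂ → E} {A m : ℝ} (hk : HBb k A)
    (hd : HBb (fun z => u z - k z) m) :
    HBb (fun z => b (u z) - b (k z)) (L * m * (1 + A)) := by
  have hL := hb.hL
  have hm := hd.nonneg
  have hA := hk.nonneg
  refine ⟨fun x hx => ?_, fun x hx y hy => ?_⟩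
  · have := hd.1 x hx
    refine (hb.h1 _ _).trans ?_
    calc _ ≤ L * m := by gcongr
      _ ≤ _ := by nlinarith [mul_nonneg (mul_nonneg (by linarith : 0 ≤ L) hm) hA]
  · set d := u y - k y with hdd
    have e : b (u x) - b (k x) - (b (u y) - b (k y)) = (b (u x) - b (k x + d)) +
        ((b (k x + d) - b (k x)) - (b (k y + d) - b (k y))) := by
      have : k y + d = u y := by rw [hdd]; abel
      rw [this]; abel
    rw [e]
    refine (norm_add_le _ _).trans ?_
    have a1 := hb.h1 (u x) (k x + d)
    have a2 := hb.h2 (k x) (k y) d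
    have a3 := hd.2 x hx y hy
    have e2 : u x - (k x + d) = u x - k x - (u y - k y) := by rw [hdd]; abel
    rw [e2] at a1
    have a4 : ‖d‖ ≤ m := hd.1 y hy
    have a5 := hk.2 x hx y hy
    calc _ ≤ L * (m * √‖x - y‖) + L * m * (A * √‖x - y‖) := by
          refine add_le_add (a1.trans ?_) (a2.trans ?_) <;> gcongr
      _ = _ := by ring

end

section
variable {E : Type*} [NormedAddCommGroup E] [NormedSpace ℝ E] [NormedSpace ℂ E] [IsScalarTower ℝ ℂ E]
  [CompleteSpace E]

def ww (τ : TOp E) (t : ℝ) (v : E) (h : ℂ → E) : E := v - t⁻¹ • (τ.T h t - τ.T h 0)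
def uu (τ : TOp E) (t : ℝ) (q v : E) (h : ℂ → E) (z : ℂ) : E :=
  q + z • ww τ t v h + (τ.T h z - τ.T h 0)
def gg (τ : TOp E) (t : ℝ) (v : E) (h : ℂ → E) (z : ℂ) : E := ww τ t v h + τ.T' h z 1

variable {τ : TOp E} {t : ℝ} {q v : E} {h k : ℂ → E} {M N : ℝ}

lemma T_lip (hh : HB h M) (x y : ℂ) : ‖τ.T h x - τ.T h y‖ ≤ τ.C * M * ‖x - y‖ :=
  Convex.norm_image_sub_le_of_norm_hasFDerivWithin_le (𝕜 := ℝ) (s := univ)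
      (fun z _ => (τ.hd h M hh z).hasFDerivWithinAt) (fun z _ => τ.hb h M hh z) convex_univ (mem_univ _) (mem_univ _)

lemma ww_bd (ht : 0 < t) (hh : HB h M) : ‖ww τ t v h‖ ≤ ‖v‖ + τ.C * M := by
  unfold ww
  refine (norm_sub_le _ _).trans ?_
  gcongr
  rw [norm_smul, norm_inv, Real.norm_of_nonneg ht.le]
  have := T_lip (τ := τ) hh t 0
  rw [sub_zero, Complex.norm_real, Real.norm_of_nonneg ht.le] at this
  calc _ ≤ t⁻¹ * (τ.C * M * t) := by gcongr
    _ = _ := by field_simp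

lemma gg_HBb (ht : 0 < t) (hh : HB h M) : HBb (gg τ t v h) (‖v‖ + 2 * (τ.C * M)) := by
  have hC := τ.hC
  have hM := hh.nonneg
  have hCM : 0 ≤ τ.C * M := by positivity
  have h1 : ∀ l : ℂ →L[ℝ] E, ‖l 1‖ ≤ ‖l‖ := fun l => by simpa using l.le_opNorm 1
  refine ⟨fun x hx => ?_, fun x hx y hy => ?_⟩
  · unfold gg
    refine (norm_add_le _ _).trans ?_
    have := ww_bd (τ := τ) (v := v) ht hh
    have := (h1 _).trans (τ.hb h M hh x)
    linarith
  · unfold gg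
    rw [add_sub_add_left_eq_sub]
    have := (h1 _).trans (τ.hH h M hh x y)
    rw [sub_apply] at this
    refine this.trans ?_
    gcongr
    linarith [norm_nonneg v]

lemma uu_HBb (ht : 0 < t) (hh : HB h M) :
    HBb (uu τ t q v h) (2 * (‖q‖ + ‖v‖ + 2 * (τ.C * M))) := by
  have hC := τ.hC
  have hM := hh.nonneg
  have hCM : 0 ≤ τ.C * M := by positivity
  have hw := ww_bd (τ := τ) (v := v) ht hh
  have hq := norm_nonneg q
  have hv := norm_nonneg v
  have hw0 := norm_nonneg (ww τ t v h)
  refine ⟨fun x hx => ?_, fun x hx y hy => ?_⟩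
  · simp only [mem_ball, dist_zero_right] at hx
    unfold uu
    refine (norm_add₃_le).trans ?_
    have h1 := T_lip (τ := τ) hh x 0
    rw [sub_zero] at h1
    rw [norm_smul]
    have h0 := norm_nonneg x
    nlinarith
  · simp only [mem_ball, dist_zero_right] at hx hy
    have e : uu τ t q v h x - uu τ t q v h y = (x - y) • ww τ t v h + (τ.T h x - τ.T h y) := by
      unfold uu; rw [sub_smul]; abel
    rw [e]
    refine (norm_add_le _ _).trans ?_
    have h1 := T_lip (τ := τ) hh x y
    rw [norm_smul]
    have h2 : ‖x - y‖ ≤ 2 * √‖x - y‖ := by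
      have := norm_sub_le x y
      have h3 := Real.sq_sqrt (norm_nonneg (x - y))
      have h4 := Real.sqrt_nonneg ‖x - y‖
      nlinarith
    have h5 := norm_nonneg (x - y)
    calc _ ≤ ‖x - y‖ * (‖v‖ + τ.C * M) + τ.C * M * ‖x - y‖ := by gcongr
      _ = (‖v‖ + 2 * (τ.C * M)) * ‖x - y‖ := by ring
      _ ≤ (‖v‖ + 2 * (τ.C * M)) * (2 * √‖x - y‖) := by gcongr
      _ ≤ _ := by nlinarith [mul_nonneg hq (Real.sqrt_nonneg ‖x - y‖)]

lemma ww_sub (hh : HB h M) (hk : HB k N) :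
    ww τ t v h - ww τ t v k = ww τ t 0 (fun z => h z - k z) := by
  unfold ww
  rw [τ.hs h M k N hh hk, τ.hs h M k N hh hk]
  simp only [smul_sub]
  abel

lemma uu_sub (hh : HB h M) (hk : HB k N) (z : ℂ) :
    uu τ t q v h z - uu τ t q v k z = uu τ t 0 0 (fun z => h z - k z) z := by
  unfold uu
  rw [τ.hs h M k N hh hk, τ.hs h M k N hh hk, ← ww_sub (v := v) hh hk, smul_sub]
  abel

lemma gg_sub (hh : HB h M) (hk : HB k N) (z : ℂ) :
    gg τ t v h z - gg τ t v k z = gg τ t 0 (fun z => h z - k z) z := by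
  unfold gg
  rw [τ.hs' h M k N hh hk, ← ww_sub (v := v) hh hk, sub_apply]
  abel

def ΦΦ (τ : TOp E) (b : E → E →L[ℝ] E) (t : ℝ) (q v : E) (h : ℂ → E) (z : ℂ) : E :=
  cutη z • b (uu τ t q v h z) (gg τ t v h z)

variable {b : E → E →L[ℝ] E} {L : ℝ}

lemma Φ_self (hb : BData b L) (ht : 0 < t) (hq : ‖q‖ ≤ M) (hv : ‖v‖ ≤ M) (hh : HB h M)
    (hM : 480 * (L * τ.C ^ 2) * M ≤ 1) : HB (ΦΦ τ b t q v h) (M / 2) := by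
  have hC := τ.hC
  have hL := hb.hL
  have hM0 := hh.nonneg
  have hC2 : τ.C * M ≤ τ.C ^ 2 * M := by nlinarith [mul_nonneg (sub_nonneg.2 hC) (mul_nonneg (by linarith : 0 ≤ τ.C) hM0)]
  have hMC : M ≤ τ.C * M := by nlinarith
  have hu : HBb (uu τ t q v h) (8 * (τ.C * M)) := (uu_HBb ht hh).mono (by linarith)
  have hg : HBb (gg τ t v h) (3 * (τ.C * M)) := (gg_HBb ht hh).mono (by linarith)
  refine (HBb.cut ((hu.bcomp hb).app hg)).mono ?_
  have : 3 * (2 * (L * (8 * (τ.C * M))) * (3 * (τ.C * M))) = 144 * (L * τ.C ^ 2) * M * M := by ring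
  rw [this]
  nlinarith

lemma Φ_contr (hb : BData b L) (ht : 0 < t) (hq : ‖q‖ ≤ M) (hv : ‖v‖ ≤ M) (hh : HB h M) (hk : HB k M)
    {m : ℝ} (hhk : HB (fun z => h z - k z) m)
    (hM : 480 * (L * τ.C ^ 2) * M ≤ 1) :
    HB (fun z => ΦΦ τ b t q v h z - ΦΦ τ b t q v k z) (m / 2) := by
  have hC := τ.hC
  have hL := hb.hL
  have hM0 := hh.nonneg
  have hm0 := hhk.nonneg
  have hMC : M ≤ τ.C * M := by nlinarith
  have hCC : τ.C ≤ L * τ.C ^ 2 := by nlinarith [mul_nonneg (sub_nonneg.2 hL) (sq_nonneg τ.C)]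
  have hCM : 480 * (τ.C * M) ≤ 1 := by nlinarith
  have hu : HBb (uu τ t q v k) (8 * (τ.C * M)) := (uu_HBb ht hk).mono (by linarith)
  have hg : HBb (gg τ t v h) (3 * (τ.C * M)) := (gg_HBb ht hh).mono (by linarith)
  have hdu : HBb (fun z => uu τ t q v h z - uu τ t q v k z) (4 * (τ.C * m)) := by
    simp only [uu_sub hh hk]
    refine (uu_HBb ht hhk).mono ?_
    simp; linarith
  have hdg : HBb (fun z => gg τ t v h z - gg τ t v k z) (2 * (τ.C * m)) := by
    simp only [gg_sub hh hk]
    refine (gg_HBb ht hhk).mono ?_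
    simp
  have h1 := ((HBb.bdiff hb hu hdu).app hg).add ((hu.bcomp hb).app hdg)
  have h2 := h1.cut
  have e : (fun z => ΦΦ τ b t q v h z - ΦΦ τ b t q v k z) = fun z => cutη z •
      ((b (uu τ t q v h z) - b (uu τ t q v k z)) (gg τ t v h z) +
        b (uu τ t q v k z) (gg τ t v h z - gg τ t v k z)) := by
    funext z
    unfold ΦΦ
    rw [← smul_sub]
    congr 1
    simp
  rw [e]
  refine h2.mono ?_
  have hp : 0 ≤ τ.C * M := by positivity
  have : 3 * (2 * (L * (4 * (τ.C * m)) * (1 + 8 * (τ.C * M))) * (3 * (τ.C * M)) +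
      2 * (L * (8 * (τ.C * M))) * (2 * (τ.C * m))) =
      (L * τ.C ^ 2 * M * m) * (72 * (1 + 8 * (τ.C * M)) + 96) := by ring
  rw [this]
  have hX : 0 ≤ L * τ.C ^ 2 * M * m := by positivity
  calc _ ≤ (L * τ.C ^ 2 * M * m) * 240 := by gcongr; linarith
    _ = (480 * (L * τ.C ^ 2) * M) * (m / 2) := by ring
    _ ≤ 1 * (m / 2) := by gcongr
    _ = _ := one_mul _

lemma lim_HB {f : ℕ → ℂ → E} {M : ℝ} (hf : ∀ k, HB (fun z => f (k+1) z - f k z) (M / 2 / 2 ^ k)) :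
    ∃ g : ℂ → E, ∀ k, HB (fun z => g z - f k z) (M / 2 ^ k) := by
  have hd : ∀ x k, dist (f k x) (f (k+1) x) ≤ M / 2 / 2 ^ k := by
    intro x k; rw [dist_comm, dist_eq_norm]; exact (hf k).1 x
  have hc : ∀ x, ∃ a, Tendsto (fun k => f k x) atTop (𝓝 a) := fun x =>
    cauchySeq_tendsto_of_complete (cauchySeq_of_le_geometric_two (hd x))
  choose g hg using hc
  refine ⟨g, fun k => ⟨fun x => ?_, fun x y => ?_⟩⟩
  · rw [← dist_eq_norm, dist_comm]
    exact dist_le_of_le_geometric_two_of_tendsto (hd x) (hg x) k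
  · have h1 : ∀ k, dist (f k x - f k y) (f (k+1) x - f (k+1) y) ≤ (M * √‖x - y‖) / 2 / 2 ^ k := by
      intro k
      have := (hf k).2 x y
      rw [dist_comm, dist_eq_norm, show f (k+1) x - f (k+1) y - (f k x - f k y) =
        f (k+1) x - f k x - (f (k+1) y - f k y) by abel]
      refine this.trans (le_of_eq ?_)
      ring
    have h2 := dist_le_of_le_geometric_two_of_tendsto h1 ((hg x).sub (hg y)) k
    rw [dist_comm, dist_eq_norm, show g x - g y - (f k x - f k y) = g x - f k x - (g y - f k y) by abel] at h2
    refine h2.trans (le_of_eq ?_)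
    ring

lemma fix_exists (hb : BData b L) (ht : 0 < t) (hq : ‖q‖ ≤ M) (hv : ‖v‖ ≤ M)
    (hM : 480 * (L * τ.C ^ 2) * M ≤ 1) : ∃ h, HB h M ∧ ∀ z, ΦΦ τ b t q v h z = h z := by
  have hM0 : 0 ≤ M := (norm_nonneg _).trans hq
  set f : ℕ → ℂ → E := fun k => (ΦΦ τ b t q v)^[k] (fun _ => 0) with hfd
  have hfs : ∀ k, f (k+1) = ΦΦ τ b t q v (f k) := fun k => Function.iterate_succ_apply' _ _ _
  have h0 : HB (f 0) M := ⟨fun x => by simpa [hfd] using hM0, fun x y => by simp [hfd]; positivity⟩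
  have hfM : ∀ k, HB (f k) M := by
    intro k
    induction k with
    | zero => exact h0
    | succ k ih => rw [hfs]; exact (Φ_self hb ht hq hv ih hM).mono (by linarith)
  have hfd' : ∀ k, HB (fun z => f (k+1) z - f k z) (M / 2 / 2 ^ k) := by
    intro k
    induction k with
    | zero =>
      have h1 := Φ_self hb ht hq hv h0 hM
      have e : (fun z => f (0+1) z - f 0 z) = ΦΦ τ b t q v (f 0) := by
        rw [hfs]; funext z; simp [hfd]
      rw [e]; simpa using h1
    | succ k ih =>
      have h1 := Φ_contr hb ht hq hv (hfM (k+1)) (hfM k) ih hM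
      rw [← hfs, ← hfs] at h1
      refine h1.mono (le_of_eq ?_)
      rw [pow_succ]; ring
  obtain ⟨g, hg⟩ := lim_HB hfd'
  have hgM : HB g M := by
    have := hg 0
    simpa [hfd] using this
  refine ⟨g, hgM, fun z => ?_⟩
  have h1 : ∀ k : ℕ, ‖ΦΦ τ b t q v g z - g z‖ ≤ (2 * M) * (1/2) ^ k := by
    intro k
    have a1 := (Φ_contr hb ht hq hv hgM (hfM k) (hg k) hM).1 z
    have a2 := (hg (k+1)).1 z
    simp only [] at a1 a2
    rw [hfs] at a2
    have e : ΦΦ τ b t q v g z - g z = (ΦΦ τ b t q v g z - ΦΦ τ b t q v (f k) z) - (g z - ΦΦ τ b t q v (f k) z) := by abel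
    rw [e]
    refine (norm_sub_le _ _).trans ((add_le_add a1 a2).trans (le_of_eq_of_le (b := M * (1/2)^k) ?_ ?_))
    · rw [pow_succ, one_div, inv_pow]; field_simp; norm_num
    · have : 0 ≤ M * (1/2:ℝ)^k := by positivity
      linarith
  have h2 : Tendsto (fun k : ℕ => (2 * M) * (1/2:ℝ) ^ k) atTop (𝓝 0) := by
    simpa using (tendsto_pow_atTop_nhds_zero_of_lt_one (r := (1/2:ℝ)) (by norm_num) (by norm_num)).const_mul (2 * M)
  have h3 := ge_of_tendsto' h2 h1
  exact sub_eq_zero.1 (norm_le_zero_iff.1 h3)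

lemma sol_exists (τ : TOp E) (hb : BData b L) (ht : 0 < t) (hq : ‖q‖ ≤ M) (hv : ‖v‖ ≤ M)
    (hM : 480 * (L * τ.C ^ 2) * M ≤ 1) : ∃ (u : ℂ → E) (u' : ℂ → ℂ →L[ℝ] E),
    (∀ z, HasFDerivAt u (u' z) z) ∧ u 0 = q ∧ u t = q + t • v ∧
    (∀ z, ‖z‖ < 1 → ‖u z‖ ≤ 8 * (τ.C * M)) ∧
    ∀ z, ‖z‖ ≤ 1 / 2 → u' z 1 + Complex.I • u' z Complex.I = (2:ℝ) • b (u z) (u' z 1) := by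
  obtain ⟨h, hh, hfix⟩ := fix_exists (τ := τ) hb ht hq hv hM
  have hM0 := hh.nonneg
  have hMC : M ≤ τ.C * M := by nlinarith [τ.hC]
  set w := ww τ t v h with hw
  have hval : ∀ z, (((ContinuousLinearMap.lsmul ℝ ℂ : ℂ →L[ℝ] E →L[ℝ] E).flip w) + τ.T' h z) 1 = gg τ t v h z := by
    intro z; simp [gg, hw]
  refine ⟨uu τ t q v h, fun z => ((ContinuousLinearMap.lsmul ℝ ℂ : ℂ →L[ℝ] E →L[ℝ] E).flip w) + τ.T' h z,
    fun z => ?_, ?_, ?_, fun z hz => ?_, fun z hz => ?_⟩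
  · have h1 : HasFDerivAt (fun z : ℂ => z • w) ((ContinuousLinearMap.lsmul ℝ ℂ : ℂ →L[ℝ] E →L[ℝ] E).flip w) z :=
      ((ContinuousLinearMap.lsmul ℝ ℂ : ℂ →L[ℝ] E →L[ℝ] E).flip w).hasFDerivAt
    exact (h1.const_add q).add ((τ.hd h M hh z).sub_const _)
  · simp [uu]
  · unfold uu ww
    rw [smul_sub, ← algebraMap_smul ℂ t⁻¹, smul_smul, ← algebraMap_smul ℂ t v]
    have : (t:ℂ) ≠ 0 := by exact_mod_cast ht.ne'
    simp [this]
    abel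
  · refine ((uu_HBb (τ := τ) (q := q) (v := v) ht hh).1 z (by simpa using hz)).trans ?_
    linarith
  · rw [hval]
    have h1 := hfix z
    unfold ΦΦ at h1
    rw [cutη_one hz, one_smul] at h1
    rw [h1, ← τ.hcr h M hh ?_ z (by linarith)]
    · simp only [add_apply, ContinuousLinearMap.flip_apply, ContinuousLinearMap.lsmul_apply, one_smul, smul_add,
        smul_smul, Complex.I_mul_I, neg_smul, gg, ← hw]
      abel
    · intro z hz
      rw [← hfix z]; unfold ΦΦ; rw [cutη_zero hz, zero_smul]
end
end

noncomputable section
set_option maxHeartbeats 400000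

lemma exists_cplx_equiv {E F : Type*} [AddCommGroup E] [Module ℝ E] [FiniteDimensional ℝ E]
    [AddCommGroup F] [Module ℝ F] [Module ℂ F] [IsScalarTower ℝ ℂ F] [FiniteDimensional ℝ F]
    (hr : Module.finrank ℝ E = Module.finrank ℝ F)
    (j : E →ₗ[ℝ] E) (hj : ∀ v, j (j v) = -v) : ∃ e : E ≃ₗ[ℝ] F, ∀ v, e (j v) = Complex.I • e v := by
  have hj' : (j : Module.End ℝ E) * j = -1 := by ext v; simp [hj]
  let φ : ℂ →ₐ[ℝ] Module.End ℝ E := Complex.lift ⟨j, hj'⟩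
  let _ : Module ℂ E := Module.compHom E (φ : ℂ →+* Module.End ℝ E)
  have hI : ∀ v : E, Complex.I • v = j v := by
    intro v
    change (φ Complex.I) v = j v
    simp [φ]
  have : IsScalarTower ℝ ℂ E := by
    refine ⟨fun a c v => ?_⟩
    change (φ (a • c)) v = a • (φ c v)
    rw [map_smul]; rfl
  have : Module.Finite ℂ E := Module.Finite.right ℝ ℂ E
  have : Module.Finite ℂ F := Module.Finite.right ℝ ℂ F
  have h1 := Module.finrank_mul_finrank ℝ ℂ E
  have h2 := Module.finrank_mul_finrank ℝ ℂ F
  have h3 : Module.finrank ℂ E = Module.finrank ℂ F := by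
    rw [Complex.finrank_real_complex] at h1 h2
    omega
  let e := LinearEquiv.ofFinrankEq E F h3
  refine ⟨e.restrictScalars ℝ, fun v => ?_⟩
  rw [← hI v]
  exact e.map_smul _ _

lemma exists_P {n : ℕ} {j : Cn n →L[ℝ] Cn n} (hj : ∀ v, j (j v) = -v) :
    ∃ P : Cn n ≃L[ℝ] Cn n, ∀ v, P (j v) = Complex.I • P v := by
  obtain ⟨e, he⟩ := exists_cplx_equiv (E := Cn n) (F := Cn n) rfl (j : Cn n →ₗ[ℝ] Cn n) hj
  exact ⟨e.toContinuousLinearEquiv, he⟩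

lemma jsq {n : ℕ} {Ω : Set (Cn n)} {J : Cn n → (Cn n →L[ℝ] Cn n)} (hJ : IsAlmostComplexOn n Ω J) :
    ∀ x ∈ Ω, ∀ v, J x (J x v) = -v := fun x hx v => by
  have := DFunLike.congr_fun (hJ.2 x hx) v
  simpa using this

lemma cdat {n : ℕ} {Ω : Set (Cn n)} {J : Cn n → (Cn n →L[ℝ] Cn n)} {x : Cn n} (hΩ : IsOpen Ω)
    (hJ : IsAlmostComplexOn n Ω J) (hx : x ∈ Ω) (k : ℕ) : ContDiffAt ℝ k J x := by
  refine (hJ.1.contDiffAt (hΩ.mem_nhds hx)).of_le ?_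
  have : (k : ℕ∞) ≤ ⊤ := le_top
  exact_mod_cast this

lemma locData_exists {n : ℕ} {Ω : Set (Cn n)} {J : Cn n → (Cn n →L[ℝ] Cn n)} {p : Cn n}
    (hΩ : IsOpen Ω) (hJ : IsAlmostComplexOn n Ω J) (hp : p ∈ Ω) :
    ∃ r C, LocData n J p r C ∧ ball p r ⊆ Ω := by
  have hsq := jsq hJ
  obtain ⟨P, hP⟩ := exists_P (hsq p hp)
  have hcd : ContDiffAt ℝ 1 J p := by exact_mod_cast cdat hΩ hJ hp 1
  obtain ⟨K, t, ht, hK⟩ := hcd.exists_lipschitzOnWith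
  obtain ⟨r₁, hr₁, hb⟩ := Metric.mem_nhds_iff.1 (inter_mem ht (hΩ.mem_nhds hp))
  set a := ‖(P : Cn n →L[ℝ] Cn n)‖ with ha
  set c := ‖(P.symm : Cn n →L[ℝ] Cn n)‖ with hc
  have ha0 : 0 ≤ a := norm_nonneg _
  have hc0 : 0 ≤ c := norm_nonneg _
  have hK0 : (0:ℝ) ≤ K := K.2
  have hKa : 0 ≤ (K:ℝ) * a * c := mul_nonneg (mul_nonneg hK0 ha0) hc0
  have hPa : ∀ v, ‖P v‖ ≤ a * ‖v‖ := (P : Cn n →L[ℝ] Cn n).le_opNorm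
  have hPc : ∀ v, ‖v‖ ≤ c * ‖P v‖ := fun v => by
    have := (P.symm : Cn n →L[ℝ] Cn n).le_opNorm (P v)
    simpa using this
  set D : ℝ := 1 + K * a * c with hD
  have hD1 : 1 ≤ D := by linarith
  set r := min r₁ (1 / D) with hr
  have hr0 : 0 < r := lt_min hr₁ (by positivity)
  have hr1 : r ≤ 1 := (min_le_right _ _).trans (by rw [div_le_one (by linarith)]; exact hD1)
  have hrK : K * a * c * r ≤ 1 := by
    have h1 : r ≤ 1 / D := min_le_right _ _
    rw [le_div_iff₀ (by linarith)] at h1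
    nlinarith
  have hsub : ball p r ⊆ ball p r₁ := ball_subset_ball (min_le_left _ _)
  clear_value r D a c
  have hLip : ∀ x ∈ ball p r, ∀ y ∈ ball p r, ‖J x - J y‖ ≤ K * ‖x - y‖ := fun x hx y hy =>
    hK.norm_sub_le (hb (hsub hx)).1 (hb (hsub hy)).1
  have hpp : p ∈ ball p r := mem_ball_self hr0
  have hJp : 0 ≤ ‖J p‖ := norm_nonneg _
  refine ⟨r, 1 + K + ‖J p‖ + a * (1 + K) + 2 * c, ⟨hr0, ?_, fun x hx => ?_, fun x hx y hy => ?_, fun x hx => ?_⟩,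
    fun x hx => (hb (hsub hx)).2⟩
  · have : 0 ≤ a * (1 + K) := by positivity
    linarith
  · have hxr : ‖p - x‖ ≤ r := by rw [← dist_eq_norm, dist_comm]; exact (mem_ball.1 hx).le
    have hd : ∀ v, ‖J p v - J x v‖ ≤ K * r * ‖v‖ := fun v => by
      calc _ = ‖(J p - J x) v‖ := by simp
        _ ≤ ‖J p - J x‖ * ‖v‖ := (J p - J x).le_opNorm v
        _ ≤ K * r * ‖v‖ := by
          gcongr; exact (hLip p hpp x hx).trans (by gcongr)
    let Q : Cn n →L[ℝ] Cn n := (P : Cn n →L[ℝ] Cn n) +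
      (1/2:ℝ) • (Complex.I • ((P : Cn n →L[ℝ] Cn n).comp (J p - J x)))
    have hQ : ∀ v, Q v = P v + (1/2:ℝ) • (Complex.I • P (J p v - J x v)) := fun v => by simp [Q]
    have hdf : ∀ v, ‖(1/2:ℝ) • (Complex.I • P (J p v - J x v))‖ ≤ 1/2 * (a * (K * r * ‖v‖)) := fun v => by
      rw [norm_smul, norm_smul, Complex.norm_I, one_mul, Real.norm_of_nonneg (by norm_num)]
      gcongr
      exact (hPa _).trans (by gcongr; exact hd v)
    refine ⟨Q, fun v => ?_, fun v => ?_, fun v => ?_⟩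
    · rw [hQ, hQ, map_sub, map_sub, hP, hP, hsq x (hb (hsub hx)).2]
      simp only [map_neg, smul_add, smul_sub, smul_neg, smul_comm Complex.I (1/2:ℝ), smul_smul Complex.I, Complex.I_mul_I, neg_smul, one_smul]
      module
    · rw [hQ]
      refine (norm_add_le _ _).trans ?_
      have h1 := hPa v
      have h2 := hdf v
      have h3 : a * (K * r * ‖v‖) ≤ a * (K * 1 * ‖v‖) := by gcongr
      have h4 : 0 ≤ (1 + K + ‖J p‖ + 2 * c) * ‖v‖ := by positivity
      have h5 : 0 ≤ a * K * ‖v‖ := by positivity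
      have h6 : (1 + K + ‖J p‖ + a * (1 + K) + 2 * c) * ‖v‖ = (1 + K + ‖J p‖ + 2 * c) * ‖v‖ + a * ‖v‖ + a * K * ‖v‖ := by ring
      have h7 : a * (K * 1 * ‖v‖) = a * K * ‖v‖ := by ring
      linarith
    · have h1 := hPc v
      have h2 : ‖P v‖ ≤ ‖Q v‖ + 1/2 * (a * (K * r * ‖v‖)) := by
        have : P v = Q v - (1/2:ℝ) • (Complex.I • P (J p v - J x v)) := by rw [hQ]; abel
        rw [this]
        exact (norm_sub_le _ _).trans (by gcongr; exact hdf v)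
      have h3 : ‖v‖ ≤ 2 * c * ‖Q v‖ := by
        have h4 : c * ‖P v‖ ≤ c * (‖Q v‖ + 1/2 * (a * (K * r * ‖v‖))) := by gcongr
        have h5 : (K * a * c * r) * ‖v‖ ≤ 1 * ‖v‖ := by gcongr
        have h6 : c * (‖Q v‖ + 1/2 * (a * (K * r * ‖v‖))) = c * ‖Q v‖ + 1/2 * ((K * a * c * r) * ‖v‖) := by ring
        linarith
      have : 0 ≤ (1 + K + ‖J p‖ + a * (1 + K)) * ‖Q v‖ := by positivity
      rw [add_mul]
      linarith
  · refine (hLip x hx y hy).trans ?_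
    gcongr
    have : 0 ≤ a * (1 + K) := by positivity
    linarith
  · have h1 := hLip x hx p hpp
    have hxr : ‖x - p‖ ≤ 1 := by rw [← dist_eq_norm]; exact (mem_ball.1 hx).le.trans hr1
    have h2 : ‖J x‖ ≤ ‖J x - J p‖ + ‖J p‖ := by simpa using norm_add_le (J x - J p) (J p)
    have : 0 ≤ a * (1 + K) := by positivity
    have h3 : K * ‖x - p‖ ≤ K * 1 := by gcongr
    linarith

lemma lip2 {E F : Type*} [NormedAddCommGroup E] [NormedSpace ℝ E] [NormedAddCommGroup F] [NormedSpace ℝ F]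
    {b : E → F} (hb : ContDiff ℝ 2 b) (hc : HasCompactSupport b) : ∃ C : ℝ, 0 ≤ C ∧
    ∀ a a' d, ‖(b (a + d) - b a) - (b (a' + d) - b a')‖ ≤ C * ‖d‖ * ‖a - a'‖ := by
  have h0 : ContDiff ℝ 1 (fderiv ℝ b) := hb.fderiv_right (by norm_num)
  have h0' : HasCompactSupport (fderiv ℝ b) := hc.fderiv (𝕜 := ℝ)
  obtain ⟨C₂, h2⟩ := h0.lipschitzWith_of_hasCompactSupport h0' (by norm_num)
  refine ⟨C₂, C₂.2, fun a a' d => ?_⟩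
  have hdb : Differentiable ℝ b := hb.differentiable (by norm_num)
  have hd : ∀ x ∈ (univ : Set E), HasFDerivWithinAt (fun a => b (a + d) - b a) (fderiv ℝ b (x + d) - fderiv ℝ b x) univ x := by
    intro x _
    have h3 : HasFDerivAt (fun a => b (a + d)) (fderiv ℝ b (x + d)) x := by
      have := (hdb (x + d)).hasFDerivAt
      exact (hasFDerivAt_comp_add_right d).2 this
    exact (h3.sub (hdb x).hasFDerivAt).hasFDerivWithinAt
  have hbd : ∀ x ∈ (univ : Set E), ‖fderiv ℝ b (x + d) - fderiv ℝ b x‖ ≤ C₂ * ‖d‖ := fun x _ => by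
    simpa using h2.norm_sub_le (x + d) x
  exact convex_univ.norm_image_sub_le_of_norm_hasFDerivWithin_le hd hbd (mem_univ a') (mem_univ a)

lemma bdata_of_smooth {E : Type*} [NormedAddCommGroup E] [NormedSpace ℝ E] {b : E → E →L[ℝ] E}
    (hb : ContDiff ℝ 2 b) (hc : HasCompactSupport b) (h0 : b 0 = 0) : ∃ L, BData b L := by
  obtain ⟨C₁, h1⟩ := hb.lipschitzWith_of_hasCompactSupport hc (by norm_num)
  obtain ⟨C₂, hc2, h2⟩ := lip2 hb hc
  have hc1 : (0:ℝ) ≤ C₁ := C₁.2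
  refine ⟨1 + C₁ + C₂, by linarith, h0, fun x y => ?_, fun a a' d => ?_⟩
  · refine (h1.norm_sub_le x y).trans ?_
    gcongr; linarith
  · refine (h2 a a' d).trans ?_
    gcongr; linarith

lemma smooth_cut {E F : Type*} [NormedAddCommGroup E] [NormedSpace ℝ E] [FiniteDimensional ℝ E]
    [HasContDiffBump E] [NormedAddCommGroup F]
    [NormedSpace ℝ F] (χ : ContDiffBump (0 : E)) {b : E → F} {R : ℝ} (hR : χ.rOut < R)
    (hb : ∀ x ∈ ball (0:E) R, ContDiffAt ℝ 2 b x) :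
    ContDiff ℝ 2 (fun u => χ u • b u) ∧ HasCompactSupport (fun u => χ u • b u) := by
  refine ⟨contDiff_iff_contDiffAt.2 fun x => ?_, χ.hasCompactSupport.smul_right⟩
  by_cases hx : x ∈ ball (0:E) R
  · exact χ.contDiff.contDiffAt.smul (hb x hx)
  · have hx' : x ∈ (closedBall (0:E) χ.rOut)ᶜ := fun h => hx (closedBall_subset_ball hR h)
    have : (fun u => χ u • b u) =ᶠ[𝓝 x] fun _ => 0 := by
      filter_upwards [isClosed_closedBall.isOpen_compl.mem_nhds hx'] with u hu
      have hu2 : ¬ dist u 0 ≤ χ.rOut := hu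
      rw [χ.zero_of_le_dist (not_le.1 hu2).le, zero_smul]
    exact contDiffAt_const.congr_of_eventuallyEq this

lemma local_nonlin {n : ℕ} {Ω : Set (Cn n)} {J : Cn n → (Cn n →L[ℝ] Cn n)} {p : Cn n}
    (hΩ : IsOpen Ω) (hJ : IsAlmostComplexOn n Ω J) (hp : p ∈ Ω) :
    ∃ (P : Cn n ≃L[ℝ] Cn n) (b : Cn n → Cn n →L[ℝ] Cn n) (L ρ : ℝ), BData b L ∧ 0 < ρ ∧
      ∀ u, ‖u‖ < ρ → p + P.symm u ∈ Ω ∧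
        ∀ v, (2:ℝ) • b u v = v + Complex.I • P (J (p + P.symm u) (P.symm v)) := by
  have hsq := jsq hJ
  obtain ⟨P, hP⟩ := exists_P (hsq p hp)
  let g : Cn n → Cn n := fun u => p + P.symm u
  have hg : ContDiff ℝ 2 g := contDiff_const.add P.symm.contDiff
  have hg0 : g 0 = p := by simp [g]
  have hev : ∀ᶠ u in 𝓝 (0 : Cn n), g u ∈ Ω :=
    hg.continuous.continuousAt.eventually (by rw [hg0]; exact hΩ.mem_nhds hp)
  obtain ⟨R, hR, hball⟩ := Metric.eventually_nhds_iff_ball.1 hev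
  let χ : ContDiffBump (0 : Cn n) := ⟨R / 4, R / 2, by positivity, by linarith⟩
  let b₀ : Cn n → Cn n →L[ℝ] Cn n := fun u =>
    (1/2:ℝ) • (Complex.I • ((P : Cn n →L[ℝ] Cn n).comp ((J (g u) - J p).comp (P.symm : Cn n →L[ℝ] Cn n))))
  have hb₀ : ∀ u, g u ∈ Ω → ContDiffAt ℝ 2 b₀ u := by
    intro u hu
    have h1 : ContDiffAt ℝ 2 J (g u) := by exact_mod_cast cdat hΩ hJ hu 2
    have h2 : ContDiffAt ℝ 2 (fun u => J (g u)) u := h1.comp u hg.contDiffAt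
    have h3 := h2.sub (contDiffAt_const (c := J p))
    have h4 := h3.clm_comp (contDiffAt_const (c := (P.symm : Cn n →L[ℝ] Cn n)))
    have h5 := (contDiffAt_const (c := (P : Cn n →L[ℝ] Cn n))).clm_comp h4
    have h6 := h5.const_smul Complex.I
    exact h6.const_smul (1/2:ℝ)
  obtain ⟨hs1, hs2⟩ := smooth_cut χ (b := b₀) (R := R) (by simp [χ]; linarith) (fun x hx => hb₀ x (hball x hx))
  obtain ⟨L, hL⟩ := bdata_of_smooth hs1 hs2 (by simp [b₀, hg0])
  refine ⟨P, _, L, R / 4, hL, by positivity, fun u hu => ⟨hball u (by simp; linarith), fun v => ?_⟩⟩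
  have : χ u = 1 := χ.one_of_mem_closedBall (by simp [χ]; linarith)
  simp only [this, one_smul, b₀, g]
  have h3 := hP (P.symm v)
  simp only [smul_apply, ContinuousLinearMap.comp_apply, sub_apply, ContinuousLinearEquiv.coe_coe, map_sub, h3,
    ContinuousLinearEquiv.apply_symm_apply, smul_sub, smul_smul Complex.I, Complex.I_mul_I, neg_smul, one_smul]
  module
end

noncomputable section
set_option maxHeartbeats 400000

lemma poincare_small {ε : ℝ} (hε : 0 < ε) :
    ∃ η : ℝ, 0 < η ∧ η < 1 ∧ ∀ z : ℂ, ‖z‖ < η → poincareDist 0 z ≤ ε := by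
  have hc : ContinuousAt (fun x : ℝ => arctanh x) 0 := by
    unfold arctanh
    have h1 : ContinuousAt (fun x : ℝ => (1 + x) / (1 - x)) 0 :=
      (continuousAt_const.add continuousAt_id).div (continuousAt_const.sub continuousAt_id) (by simp)
    exact continuousAt_const.mul (h1.log (by simp))
  have h0 : arctanh 0 = 0 := by simp [arctanh]
  have := hc.eventually (gt_mem_nhds (show arctanh 0 < ε by rw [h0]; exact hε))
  obtain ⟨η, hη, hb⟩ := Metric.eventually_nhds_iff_ball.1 this
  refine ⟨min η (1/2), by positivity, (min_le_right _ _).trans_lt (by norm_num), fun z hz => ?_⟩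
  have h2 : ‖z‖ < η := hz.trans_le (min_le_left _ _)
  have := hb ‖z‖ (by simpa using h2)
  simpa [poincareDist] using this.le

lemma cr_of {n : ℕ} {P : Cn n ≃L[ℝ] Cn n} {j : Cn n →L[ℝ] Cn n} {A : ℂ →L[ℝ] Cn n} (hj : ∀ v, j (j v) = -v)
    (h : A 1 + Complex.I • A Complex.I = A 1 + Complex.I • P (j (P.symm (A 1)))) (ξ : ℂ) :
    P.symm (A (Complex.I * ξ)) = j (P.symm (A ξ)) := by
  have h1 : A Complex.I = P (j (P.symm (A 1))) := smul_right_injective _ Complex.I_ne_zero (add_left_cancel h)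
  have h2 : P.symm (A Complex.I) = j (P.symm (A 1)) := by rw [h1]; simp
  have e1 : ξ = ξ.re • (1:ℂ) + ξ.im • Complex.I := by
    apply Complex.ext <;> simp
  have e2 : Complex.I * ξ = ξ.re • Complex.I - ξ.im • (1:ℂ) := by
    apply Complex.ext <;> simp
  rw [e2]
  conv_rhs => rw [e1]
  simp only [map_add, map_sub, map_smul, h2, hj]
  module

lemma small_disc {n : ℕ} {Ω : Set (Cn n)} {J : Cn n → (Cn n →L[ℝ] Cn n)} {p : Cn n}
    (hΩ : IsOpen Ω) (hJ : IsAlmostComplexOn n Ω J) (hp : p ∈ Ω) {ε : ℝ} (hε : 0 < ε) :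
    ∃ δ > 0, ∀ x y, ‖x - p‖ < δ → ‖y - p‖ < δ → ∃ (f : ℂ → Cn n) (w : ℂ), IsJHolomorphicOn n Ω J 1 f ∧
      w ∈ ball (0:ℂ) 1 ∧ f 0 = x ∧ f w = y ∧ poincareDist 0 w ≤ ε := by
  obtain ⟨P, b, L, ρ, hb, hρ, hloc⟩ := local_nonlin hΩ hJ hp
  obtain ⟨τ⟩ := exists_TOp (E := Cn n)
  obtain ⟨η, hη, hη1, hpd⟩ := poincare_small hε
  have hL := hb.hL
  have hC := τ.hC
  have hL0 : 0 < L := by linarith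
  have hC0 : 0 < τ.C := by linarith
  obtain ⟨M, hM0, hM1, hM2⟩ : ∃ M : ℝ, 0 < M ∧ 480 * (L * τ.C ^ 2) * M ≤ 1 ∧ 8 * (τ.C * M) < ρ := by
    refine ⟨min (1 / (480 * (L * τ.C ^ 2))) (ρ / (16 * τ.C)), by positivity, ?_, ?_⟩
    · have h1 := min_le_left (1 / (480 * (L * τ.C ^ 2))) (ρ / (16 * τ.C))
      rw [le_div_iff₀ (by positivity)] at h1
      linarith
    · have h1 := min_le_right (1 / (480 * (L * τ.C ^ 2))) (ρ / (16 * τ.C))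
      rw [le_div_iff₀ (by positivity)] at h1
      linarith
  set t := η / 4 with ht
  have ht0 : 0 < t := by positivity
  have ht1 : t < 1 := by linarith
  set a := ‖(P : Cn n →L[ℝ] Cn n)‖ + 1 with ha
  have ha0 : 0 < a := by positivity
  have hPa : ∀ v, ‖P v‖ ≤ a * ‖v‖ := fun v => ((P : Cn n →L[ℝ] Cn n).le_opNorm v).trans (by gcongr; linarith)
  have hδ : a * (M * t / (2 * a)) = M * t / 2 := by field_simp
  refine ⟨M * t / (2 * a), by positivity, fun x y hx hy => ?_⟩
  have hx1 : ‖P (x - p)‖ ≤ M * t / 2 := (hPa _).trans (by rw [← hδ]; gcongr)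
  have hy1 : ‖P (y - p)‖ ≤ M * t / 2 := (hPa _).trans (by rw [← hδ]; gcongr)
  have hMt : M * t ≤ M := by nlinarith
  obtain ⟨u, u', hu, hu0, hut, hub, hcr⟩ := sol_exists (q := P (x - p)) (v := t⁻¹ • (P (y - p) - P (x - p)))
    τ hb ht0 (M := M) (by linarith) (by
      rw [norm_smul, norm_inv, Real.norm_of_nonneg ht0.le, inv_mul_le_iff₀ ht0]
      refine (norm_sub_le _ _).trans ?_
      linarith) hM1
  have hz2 : ∀ z ∈ ball (0:ℂ) 1, ‖(1/2:ℝ) • z‖ < 1/2 := fun z hz => by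
    rw [norm_smul, Real.norm_of_nonneg (by norm_num)]
    have : ‖z‖ < 1 := by simpa using hz
    linarith
  have hloc' : ∀ z ∈ ball (0:ℂ) 1, _ := fun z hz =>
    hloc (u ((1/2:ℝ) • z)) ((hub _ (by linarith [hz2 z hz])).trans_lt hM2)
  refine ⟨fun z => p + P.symm (u ((1/2:ℝ) • z)), ((2 * t : ℝ) : ℂ), ⟨fun z hz => (hloc' z hz).1, fun z hz => ?_⟩,
    ?_, ?_, ?_, ?_⟩
  · have h1 : HasFDerivAt (fun z : ℂ => (1/2:ℝ) • z) ((1/2:ℝ) • ContinuousLinearMap.id ℝ ℂ) z :=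
      (hasFDerivAt_id z).const_smul (1/2:ℝ)
    have h2 := (P.symm : Cn n →L[ℝ] Cn n).hasFDerivAt.comp z ((hu ((1/2:ℝ) • z)).comp z h1)
    have h3 : HasFDerivAt (fun z => p + P.symm (u ((1/2:ℝ) • z))) _ z := h2.const_add p
    refine ⟨h3.differentiableAt, fun ξ => ?_⟩
    rw [h3.fderiv]
    have h4 := hcr ((1/2:ℝ) • z) (hz2 z hz).le
    rw [(hloc' z hz).2] at h4
    have h5 := cr_of (jsq hJ _ (hloc' z hz).1) h4 ((1/2:ℝ) • ξ)
    simp only [ContinuousLinearMap.comp_apply, smul_apply, ContinuousLinearMap.id_apply,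
      ContinuousLinearEquiv.coe_coe]
    rw [← h5, mul_smul_comm]
  · rw [mem_ball_zero_iff, Complex.norm_real, Real.norm_of_nonneg (by positivity)]; linarith
  · simp [hu0]
  · have : (1/2:ℝ) • ((2 * t : ℝ) : ℂ) = (t : ℂ) := by
      rw [Complex.real_smul]; push_cast; ring
    beta_reduce
    rw [this, hut, smul_smul, mul_inv_cancel₀ ht0.ne', one_smul]
    simp
  · apply hpd
    rw [Complex.norm_real, Real.norm_of_nonneg (by positivity)]; linarith
end

noncomputable section
set_option maxHeartbeats 400000

lemma chain3 {n : ℕ} {Ω : Set (Cn n)} {J : Cn n → (Cn n →L[ℝ] Cn n)} {p q : Cn n} {ε : ℝ}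
    {f₁ f₂ f₃ : ℂ → Cn n} {w₁ w₂ w₃ : ℂ} (h₁ : IsJHolomorphicOn n Ω J 1 f₁) (h₂ : IsJHolomorphicOn n Ω J 1 f₂)
    (h₃ : IsJHolomorphicOn n Ω J 1 f₃) (hw₁ : w₁ ∈ ball (0:ℂ) 1) (hw₂ : w₂ ∈ ball (0:ℂ) 1)
    (hw₃ : w₃ ∈ ball (0:ℂ) 1) (e₁ : f₁ 0 = p) (e₂ : f₁ w₁ = f₂ 0) (e₃ : f₂ w₂ = f₃ 0) (e₄ : f₃ w₃ = q)
    (d₁ : poincareDist 0 w₁ ≤ ε) (d₂ : poincareDist 0 w₂ ≤ ε) (d₃ : poincareDist 0 w₃ ≤ ε) :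
    kobayashiDist n Ω J p q ≤ ENNReal.ofReal (3 * ε) := by
  have h0 : (0:ℂ) ∈ ball (0:ℂ) 1 := by simp
  unfold kobayashiDist
  refine le_trans (sInf_le ?_) (?_ : ENNReal.ofReal (∑ k : Fin 3, poincareDist ((![0, 0, 0] : Fin 3 → ℂ) k) ((![w₁, w₂, w₃] : Fin 3 → ℂ) k)) ≤ _)
  · refine ⟨2, ![0, 0, 0], ![w₁, w₂, w₃], ![f₁, f₂, f₃], ?_, e₁, ?_, e₄, rfl⟩
    · intro k
      fin_cases k
      · exact ⟨h0, hw₁, h₁⟩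
      · exact ⟨h0, hw₂, h₂⟩
      · exact ⟨h0, hw₃, h₃⟩
    · intro k
      fin_cases k
      · exact e₂
      · exact e₃
  · apply ENNReal.ofReal_le_ofReal
    rw [Fin.sum_univ_three]
    change poincareDist 0 w₁ + poincareDist 0 w₂ + poincareDist 0 w₃ ≤ _
    linarith

lemma cross_sphere {n : ℕ} {Ω : Set (Cn n)} {J : Cn n → (Cn n →L[ℝ] Cn n)} {p : Cn n} {f : ℂ → Cn n} {e η : ℝ}
    (hf : IsJHolomorphicOn n Ω J 1 f) (hη : η < 1) (h0 : ‖f 0 - p‖ < e)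
    (h : ∃ z, ‖z‖ < η ∧ e ≤ ‖f z - p‖) : ∃ z, ‖z‖ < η ∧ ‖f z - p‖ = e := by
  obtain ⟨z, hz, hze⟩ := h
  have hsz : ∀ s ∈ Icc (0:ℝ) 1, ‖s • z‖ < η := fun s hs => by
    rw [norm_smul, Real.norm_of_nonneg hs.1]
    have := mul_le_of_le_one_left (norm_nonneg z) hs.2
    linarith
  have hc : ContinuousOn (fun s : ℝ => ‖f (s • z) - p‖) (Icc 0 1) := by
    intro s hs
    have h1 : ContinuousAt f (s • z) := (hf.2 _ (by rw [mem_ball_zero_iff]; linarith [hsz s hs])).1.continuousAt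
    have h2 : ContinuousAt (fun s : ℝ => s • z) s := by fun_prop
    have h3 : ContinuousAt (fun s : ℝ => f (s • z)) s := ContinuousAt.comp h1 h2
    exact ((h3.sub continuousAt_const).norm).continuousWithinAt
  have := intermediate_value_Icc (zero_le_one) hc
  obtain ⟨s, hs, hse⟩ := this (show e ∈ Icc _ _ from ⟨by simpa using h0.le, by simpa using hze⟩)
  exact ⟨s • z, hsz s hs, hse⟩

lemma big_disc {n : ℕ} {Ω : Set (Cn n)} {J : Cn n → (Cn n →L[ℝ] Cn n)} {K : Set (Cn n)}
    (h : sInf {c : ℝ≥0∞ | ∃ p ∈ K, ∃ v : Cn n, ‖v‖ = 1 ∧ c = kobayashiRoyden n Ω J p v} = 0) (k : ℕ) :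
    ∃ p ∈ K, ∃ f, IsJHolomorphicOn n Ω J 1 f ∧ f 0 = p ∧ (k : ℝ) < ‖fderiv ℝ f 0‖ := by
  have h1 : sInf {c : ℝ≥0∞ | ∃ p ∈ K, ∃ v : Cn n, ‖v‖ = 1 ∧ c = kobayashiRoyden n Ω J p v} <
      ENNReal.ofReal (1 / (k + 1)) := by rw [h]; simp; positivity
  obtain ⟨c, ⟨p, hp, v, hv, rfl⟩, hc⟩ := sInf_lt_iff.1 h1
  obtain ⟨c, ⟨r, hr, ⟨f, hf, hf0, hfd⟩, rfl⟩, hc⟩ := sInf_lt_iff.1 hc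
  refine ⟨p, hp, f, hf, hf0, ?_⟩
  rw [ENNReal.ofReal_lt_ofReal_iff (by positivity), one_div_lt_one_div hr (by positivity)] at hc
  have h2 := (fderiv ℝ f 0).le_opNorm 1
  rw [hfd, norm_smul, hv, Real.norm_of_nonneg hr.le, norm_one] at h2
  linarith

lemma hyperbolic_imp_bounded_below {n : ℕ} {Ω : Set (Cn n)} {J : Cn n → (Cn n →L[ℝ] Cn n)} {K : Set (Cn n)}
    (hΩ : IsOpen Ω) (hJ : IsAlmostComplexOn n Ω J)
    (hyp : ∀ p ∈ Ω, ∀ q ∈ Ω, p ≠ q → 0 < kobayashiDist n Ω J p q) (hKΩ : K ⊆ Ω) (hK : IsCompact K) :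
    0 < sInf {c : ℝ≥0∞ | ∃ p ∈ K, ∃ v : Cn n, ‖v‖ = 1 ∧ c = kobayashiRoyden n Ω J p v} := by
  by_contra hcon
  have hcon := big_disc (nonpos_iff_eq_zero.1 (not_lt.1 hcon))
  choose pk hpk fk hfk hf0 hfd using hcon
  obtain ⟨p, hpK, φ, hφ, hlim⟩ := hK.tendsto_subseq hpk
  have hp := hKΩ hpK
  obtain ⟨r, C, hLoc, hrΩ⟩ := locData_exists hΩ hJ hp
  obtain ⟨r', hr', N, hN⟩ := grad_final hLoc
  obtain ⟨e, he, her, her'⟩ : ∃ e : ℝ, 0 < e ∧ e < r ∧ e < r' :=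
    ⟨min r r' / 2, by have := lt_min hLoc.1 hr'; linarith,
      by have := min_le_left r r'; have := lt_min hLoc.1 hr'; linarith,
      by have := min_le_right r r'; have := lt_min hLoc.1 hr'; linarith⟩
  have key : ∀ j : ℕ, ∃ (f : ℂ → Cn n) (z : ℂ), IsJHolomorphicOn n Ω J 1 f ∧ ‖f 0 - p‖ < 1 / (j + 1) ∧
      ‖z‖ < 1 / (j + 2) ∧ ‖f z - p‖ = e := by
    intro j
    set η : ℝ := 1 / (j + 2) with hη
    have hη0 : 0 < η := by positivity
    have hη1 : η < 1 := by rw [hη, div_lt_one (by positivity)]; linarith [Nat.cast_nonneg (α := ℝ) j]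
    have ev1 : ∀ᶠ k in atTop, ‖pk (φ k) - p‖ < min e (1 / (j + 1)) := by
      have := hlim.eventually (ball_mem_nhds p (show 0 < min e (1 / ((j:ℝ) + 1)) by positivity))
      filter_upwards [this] with k hk
      rw [dist_eq_norm] at hk
      exact hk
    have ev2 : ∀ᶠ k : ℕ in atTop, N / η ≤ k := eventually_ge_atTop ⌈N / η⌉₊ |>.mono fun k hk =>
      (Nat.le_ceil _).trans (by exact_mod_cast hk)
    obtain ⟨k, hk1, hk2⟩ := (ev1.and ev2).exists
    have hkk : (k:ℝ) ≤ φ k := by exact_mod_cast hφ.id_le k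
    have hk3 := hk1.trans_le (min_le_left _ _)
    have hk4 := hk1.trans_le (min_le_right _ _)
    rw [← hf0 (φ k)] at hk3 hk4
    obtain ⟨z, hz, hze⟩ := cross_sphere (hfk (φ k)) hη1 hk3 (by
      by_contra hno
      push Not at hno
      have hb : ball (0:ℂ) η ⊆ ball 0 1 := ball_subset_ball hη1.le
      have := hN (fk (φ k)) 0 η hη0 ⟨fun z hz => ?_, fun z hz => (hfk (φ k)).2 z (hb hz)⟩
      · linarith [hfd (φ k)]
      · rw [mem_ball, dist_eq_norm]
        exact (hno z (by simpa using hz)).trans her')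
    exact ⟨fk (φ k), z, hfk _, hk4, hz, hze⟩
  choose f z hf h0 hz hze using key
  obtain ⟨q, hq, ψ, hψ, hlq⟩ := (isCompact_sphere p e).tendsto_subseq
    (fun j => show f j (z j) ∈ sphere p e by rw [mem_sphere, dist_eq_norm]; exact hze j)
  have hqe : dist q p = e := hq
  have hqΩ : q ∈ Ω := hrΩ (by rw [mem_ball, hqe]; exact her)
  have hpq : p ≠ q := by rintro rfl; simp at hqe; linarith
  refine (hyp p hp q hqΩ hpq).ne' ?_
  have hle : ∀ ε : ℝ, 0 < ε → kobayashiDist n Ω J p q ≤ ENNReal.ofReal (3 * ε) := by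
    intro ε hε
    obtain ⟨δ₁, hδ₁, H₁⟩ := small_disc hΩ hJ hp hε
    obtain ⟨δ₂, hδ₂, H₂⟩ := small_disc hΩ hJ hqΩ hε
    obtain ⟨η, hη, hη1, hpd⟩ := poincare_small hε
    have ev1 : ∀ᶠ k in atTop, ‖f (ψ k) (z (ψ k)) - q‖ < δ₂ := by
      filter_upwards [hlq.eventually (ball_mem_nhds q hδ₂)] with k hk
      rw [dist_eq_norm] at hk
      exact hk
    have hsm : ∀ᶠ j : ℕ in atTop, 1 / ((j:ℝ) + 1) < min δ₁ η :=
      tendsto_one_div_add_atTop_nhds_zero_nat.eventually (gt_mem_nhds (lt_min hδ₁ hη))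
    obtain ⟨k, hk1, hk2⟩ := (ev1.and (hψ.tendsto_atTop.eventually hsm)).exists
    have hj := h0 (ψ k)
    have hzj : ‖z (ψ k)‖ < η := by
      have h1 := hz (ψ k)
      have h2 : 1 / ((ψ k:ℝ) + 2) ≤ 1 / ((ψ k:ℝ) + 1) := by gcongr; norm_num
      have h3 := min_le_right δ₁ η
      linarith
    have hfj : ‖f (ψ k) 0 - p‖ < δ₁ := by
      have h3 := min_le_left δ₁ η
      linarith
    obtain ⟨g₁, w₁, hg₁, hw₁, a₁, b₁, d₁⟩ := H₁ p (f (ψ k) 0) (by simpa using hδ₁) hfj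
    obtain ⟨g₂, w₂, hg₂, hw₂, a₂, b₂, d₂⟩ := H₂ (f (ψ k) (z (ψ k))) q hk1 (by simpa using hδ₂)
    exact chain3 hg₁ (hf (ψ k)) hg₂ hw₁ (by rw [mem_ball_zero_iff]; linarith) hw₂ a₁ b₁ a₂.symm b₂ d₁ (hpd _ hzj) d₂
  by_contra hne
  have hpos : 0 < kobayashiDist n Ω J p q := pos_iff_ne_zero.2 hne
  obtain ⟨x, hx0, hx⟩ := ENNReal.lt_iff_exists_nnreal_btwn.1 hpos
  have hx0' : (0:ℝ) < x := by exact_mod_cast hx0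
  have := hle (x / 3) (by positivity)
  rw [mul_div_cancel₀ _ (by norm_num : (3:ℝ) ≠ 0), ENNReal.ofReal_coe_nnreal] at this
  exact absurd hx (not_lt.2 this)
end

/-- `(Ω, J)` is hyperbolic iff the Kobayashi–Royden pseudonorm on unit
vectors is bounded away from zero on every compact subset of `Ω`. -/
theorem hyperbolic_iff_kobayashiRoyden_bounded_below
    (n : ℕ) (hn : 1 ≤ n) (Ω : Set (Cn n)) (hΩ : IsOpen Ω) (hconn : IsConnected Ω)
    (J : Cn n → (Cn n →L[ℝ] Cn n)) (hJ : IsAlmostComplexOn n Ω J) :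
    (∀ p ∈ Ω, ∀ q ∈ Ω, p ≠ q → 0 < kobayashiDist n Ω J p q) ↔
      (∀ K : Set (Cn n), K ⊆ Ω → IsCompact K →
        0 < sInf {c : ℝ≥0∞ | ∃ p ∈ K, ∃ v : Cn n, ‖v‖ = 1 ∧
          c = kobayashiRoyden n Ω J p v}) := by
  exact ⟨fun h K hKΩ hK => hyperbolic_imp_bounded_below hΩ hJ h hKΩ hK,
    fun h p hp q _ hpq => bounded_below_imp_hyperbolic hΩ h hp hpq⟩
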